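/- arXiv:1801.04643 — 2 statements merged into one kernel-verified Lean document; each statement's English description precedes it below -/
import Mathlib

section
/- For |q|<1, the identity 1 + 6·S(q;q³) = 3 J_{3,6}² J₆³/(2 J_{1,6}² J₂) − J_{1,6}⁶ J₂³ J_{3,6}²/(2 J₆⁹) holds, where S(a;Q) := Σ_{n≥0} (1/(1-aQ^n) - 1/(1-a^{-1}Q^{n+1})). -/
open scoped BigOperators

noncomputable def poch (a q : ℂ) : ℂ := ∏' n : ℕ, (1 - a * q ^ n)

noncomputable def Jm (m : ℕ) (q : ℂ) : ℂ := poch (q ^ m) (q ^ m)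

noncomputable def Jam (a m : ℕ) (q : ℂ) : ℂ :=
  poch (q ^ a) (q ^ m) * poch (q ^ (m - a)) (q ^ m) * poch (q ^ m) (q ^ m)

noncomputable def Sser (a Q : ℂ) : ℂ :=
  ∑' n : ℕ, (1 / (1 - a * Q ^ n) - 1 / (1 - a⁻¹ * Q ^ (n + 1)))

noncomputable def jacNode (Q : ℂ) (k : ℕ) : ℂ := Q ^ k + (Q ^ k)⁻¹

noncomputable def jacRatio (Q : ℂ) (k : ℕ) : ℂ := (1 + Q ^ k) / (1 - Q ^ k)

noncomputable def jacProd (Q : ℂ) (M : ℕ) : ℂ := ∏ j ∈ Finset.range M, jacRatio Q (j + 1)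

theorem pow_ne_neg_one_of_norm_lt_one {Q : ℂ} (hQ : ‖Q‖ < 1) {k : ℕ} (hk : k ≠ 0) :
    1 + Q ^ k ≠ 0 := by
  intro h
  have h1 : Q ^ k = -1 := by linear_combination h
  have h2 : ‖Q ^ k‖ < 1 := by
    rw [norm_pow]; exact pow_lt_one₀ (norm_nonneg _) hQ hk
  simp [h1] at h2

theorem one_sub_pow_ne_zero_of_norm_lt_one {Q : ℂ} (hQ : ‖Q‖ < 1) {k : ℕ} (hk : k ≠ 0) :
    1 - Q ^ k ≠ 0 := by
  intro h
  have h1 : Q ^ k = 1 := by linear_combination -h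
  have h2 : ‖Q ^ k‖ < 1 := by
    rw [norm_pow]; exact pow_lt_one₀ (norm_nonneg _) hQ hk
  simp [h1] at h2

theorem jacRatio_ne_zero {Q : ℂ} (hQ : ‖Q‖ < 1) {k : ℕ} (hk : k ≠ 0) : jacRatio Q k ≠ 0 :=
  div_ne_zero (pow_ne_neg_one_of_norm_lt_one hQ hk) (one_sub_pow_ne_zero_of_norm_lt_one hQ hk)

theorem jacProd_ne_zero {Q : ℂ} (hQ : ‖Q‖ < 1) (M : ℕ) : jacProd Q M ≠ 0 :=
  Finset.prod_ne_zero_iff.2 fun _ _ => jacRatio_ne_zero hQ (Nat.succ_ne_zero _)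

theorem jacProd_succ (Q : ℂ) (M : ℕ) : jacProd Q (M + 1) = jacProd Q M * jacRatio Q (M + 1) :=
  Finset.prod_range_succ _ _

theorem jacProd_add (Q : ℂ) (M d : ℕ) :
    jacProd Q (M + d) = jacProd Q M * ∏ j ∈ Finset.range d, jacRatio Q (M + j + 1) :=
  Finset.prod_range_add _ _ _

theorem jacNode_sub {Q : ℂ} (hQ0 : Q ≠ 0) (k d : ℕ) :
    jacNode Q (k + d) - jacNode Q k = (Q ^ (k + d))⁻¹ * (1 - Q ^ d) * (1 - Q ^ (2 * k + d)) := by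
  have h := pow_ne_zero k hQ0
  have h' := pow_ne_zero d hQ0
  simp only [jacNode, pow_add, two_mul]
  field_simp
  ring

theorem jacNode_add {Q : ℂ} (hQ0 : Q ≠ 0) (k d : ℕ) :
    jacNode Q (k + d) + jacNode Q k = (Q ^ (k + d))⁻¹ * (1 + Q ^ d) * (1 + Q ^ (2 * k + d)) := by
  have h := pow_ne_zero k hQ0
  have h' := pow_ne_zero d hQ0
  simp only [jacNode, pow_add, two_mul]
  field_simp
  ring

theorem jacNode_injective {Q : ℂ} (hQ0 : Q ≠ 0) (hQ : ‖Q‖ < 1) :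
    Function.Injective (jacNode Q) := by
  have key : ∀ k d, d ≠ 0 → jacNode Q (k + d) - jacNode Q k ≠ 0 := by
    intro k d hd
    rw [jacNode_sub hQ0]
    exact mul_ne_zero (mul_ne_zero (inv_ne_zero (pow_ne_zero _ hQ0))
      (one_sub_pow_ne_zero_of_norm_lt_one hQ hd))
      (one_sub_pow_ne_zero_of_norm_lt_one hQ (by omega))
  intro a b hab
  by_contra hne
  rcases Nat.lt_or_gt_of_ne hne with h | h
  · obtain ⟨d, rfl⟩ := Nat.exists_eq_add_of_lt h
    exact key a (d + 1) (by omega) (by rw [← add_assoc, hab, sub_self])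
  · obtain ⟨d, rfl⟩ := Nat.exists_eq_add_of_lt h
    exact key b (d + 1) (by omega) (by rw [← add_assoc, hab, sub_self])

theorem jacNode_div {Q : ℂ} (hQ0 : Q ≠ 0) (k d : ℕ) :
    (jacNode Q (k + d) + jacNode Q k) / (jacNode Q (k + d) - jacNode Q k)
      = jacRatio Q d * jacRatio Q (2 * k + d) := by
  rw [jacNode_sub hQ0, jacNode_add hQ0, mul_assoc, mul_assoc,
    mul_div_mul_left _ _ (inv_ne_zero (pow_ne_zero _ hQ0)), jacRatio, jacRatio, div_mul_div_comm]

theorem prod_erase_jacNode_self {Q : ℂ} (hQ0 : Q ≠ 0) (n : ℕ) :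
    ∏ k ∈ (Finset.range (n + 1)).erase n,
      (jacNode Q n + jacNode Q k) / (jacNode Q n - jacNode Q k)
      = jacProd Q n * ∏ k ∈ Finset.range n, jacRatio Q (n + k) := by
  have h1 : (Finset.range (n + 1)).erase n = Finset.range n := by
    rw [Finset.range_add_one, Finset.erase_insert (by simp)]
  rw [h1, jacProd, ← Finset.prod_range_reflect (fun j => jacRatio Q (j + 1)), ← Finset.prod_mul_distrib]
  refine Finset.prod_congr rfl fun k hk => ?_
  rw [Finset.mem_range] at hk
  obtain ⟨d, rfl⟩ := Nat.exists_eq_add_of_lt hk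
  rw [add_assoc k d 1, jacNode_div hQ0]
  congr 2 <;> omega

theorem prod_erase_jacNode {Q : ℂ} (hQ0 : Q ≠ 0) (n d : ℕ) :
    ∏ k ∈ (Finset.range (n + d + 1)).erase n,
      (jacNode Q n + jacNode Q k) / (jacNode Q n - jacNode Q k)
      = (-1) ^ d * jacProd Q d * (∏ j ∈ Finset.range d, jacRatio Q (2 * n + j + 1))
        * (jacProd Q n * ∏ k ∈ Finset.range n, jacRatio Q (n + k)) := by
  induction d with
  | zero => simpa [jacProd] using prod_erase_jacNode_self hQ0 n
  | succ d ih =>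
    have h1 : (Finset.range (n + (d + 1) + 1)).erase n
        = insert (n + d + 1) ((Finset.range (n + d + 1)).erase n) := by
      ext x; simp only [Finset.mem_erase, Finset.mem_range, Finset.mem_insert]; omega
    have h2 := jacNode_div hQ0 n (d + 1)
    rw [h1, Finset.prod_insert (by simp), ih, jacProd_succ, Finset.prod_range_succ,
      ← neg_sub (jacNode Q (n + d + 1)), add_comm (jacNode Q n), div_neg, add_assoc n d 1, h2,
      ← add_assoc]
    ring

theorem eval_mul_nodalWeight_zero {Q : ℂ} (hQ0 : Q ≠ 0) (N : ℕ) :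
    Lagrange.nodalWeight (Finset.range (N + 1)) (jacNode Q) 0
      * ∏ k ∈ Finset.range N, (jacNode Q 0 + jacNode Q (k + 1)) = (-1) ^ N * jacProd Q N ^ 2 := by
  have h := prod_erase_jacNode hQ0 0 N
  have h1 : (Finset.range (N + 1)).erase 0 = (Finset.range N).map (addRightEmbedding 1) := by
    ext x
    simp only [Finset.mem_erase, Finset.mem_range, Finset.mem_map, addRightEmbedding_apply]
    constructor
    · rintro ⟨h1, h2⟩
      exact ⟨x - 1, by omega, by omega⟩
    · rintro ⟨a, h1, rfl⟩
      omega
  rw [zero_add, h1, Finset.prod_map] at h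
  rw [Lagrange.nodalWeight, h1, Finset.prod_map, ← Finset.prod_mul_distrib]
  simp only [addRightEmbedding_apply, div_eq_mul_inv, mul_comm (_ + _)] at h ⊢
  rw [h]
  simp only [mul_zero, zero_add, Finset.range_zero, Finset.prod_empty, jacProd]
  ring

theorem eval_mul_nodalWeight_succ {Q : ℂ} (hQ0 : Q ≠ 0) (hQ : ‖Q‖ < 1) (m d : ℕ) :
    Lagrange.nodalWeight (Finset.range (m + 1 + d + 1)) (jacNode Q) (m + 1)
      * ∏ k ∈ Finset.range (m + 1 + d), (jacNode Q (m + 1) + jacNode Q (k + 1))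
      = 2 * (-1) ^ d * jacProd Q d * jacProd Q (2 * (m + 1) + d) := by
  have h := prod_erase_jacNode hQ0 (m + 1) d
  have hmem : m + 1 ∈ Finset.range (m + 1 + d + 1) := by simp
  have hp : (∏ k ∈ Finset.range (m + 1 + d), (jacNode Q (m + 1) + jacNode Q (k + 1)))
      * (jacNode Q (m + 1) + jacNode Q 0) = (jacNode Q (m + 1) + jacNode Q (m + 1)) *
      ∏ k ∈ (Finset.range (m + 1 + d + 1)).erase (m + 1), (jacNode Q (m + 1) + jacNode Q k) := by
    rw [Finset.mul_prod_erase _ (fun k => jacNode Q (m + 1) + jacNode Q k) hmem,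
      Finset.prod_range_succ']
  rw [Finset.prod_div_distrib, div_eq_mul_inv, ← Finset.prod_inv_distrib,
    ← Lagrange.nodalWeight] at h
  set W := Lagrange.nodalWeight (Finset.range (m + 1 + d + 1)) (jacNode Q) (m + 1)
  have e1 : jacProd Q (2 * (m + 1) + d) = jacProd Q m * (∏ k ∈ Finset.range (m + 1),
      jacRatio Q (m + 1 + k)) * jacRatio Q (2 * (m + 1)) *
      ∏ j ∈ Finset.range d, jacRatio Q (2 * (m + 1) + j + 1) := by
    rw [jacProd_add, show 2 * (m + 1) = m + (m + 1) + 1 by ring, jacProd_succ, jacProd_add]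
    simp only [add_right_comm m _ 1]
  have e2 : jacNode Q (m + 1) + jacNode Q (m + 1)
      = (Q ^ (m + 1))⁻¹ * 2 * (1 + Q ^ (2 * (m + 1))) := by
    simpa [one_add_one_eq_two] using jacNode_add hQ0 (m + 1) 0
  have e3 : jacNode Q (m + 1) + jacNode Q 0
      = (Q ^ (m + 1))⁻¹ * (1 + Q ^ (m + 1)) * (1 + Q ^ (m + 1)) := by
    simpa using jacNode_add hQ0 0 (m + 1)
  have n1 : 1 + Q ^ (m + 1) ≠ 0 := pow_ne_neg_one_of_norm_lt_one hQ (by omega)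
  have n2 : 1 - Q ^ (m + 1) ≠ 0 := one_sub_pow_ne_zero_of_norm_lt_one hQ (by omega)
  have n3 : 1 - Q ^ (2 * (m + 1)) ≠ 0 := one_sub_pow_ne_zero_of_norm_lt_one hQ (by omega)
  have n4 := pow_ne_zero (m + 1) hQ0
  have e4 : (jacNode Q (m + 1) + jacNode Q (m + 1)) * jacRatio Q (m + 1)
      = 2 * jacRatio Q (2 * (m + 1)) * (jacNode Q (m + 1) + jacNode Q 0) := by
    rw [e2, e3, jacRatio, jacRatio]
    field_simp
    ring
  have n5 : jacNode Q (m + 1) + jacNode Q 0 ≠ 0 := by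
    rw [e3]; exact mul_ne_zero (mul_ne_zero (inv_ne_zero n4) n1) n1
  apply mul_right_cancel₀ n5
  rw [mul_assoc, hp, e1, mul_left_comm, mul_comm W, h, jacProd_succ]
  linear_combination (-1) ^ d * jacProd Q d *
    (∏ j ∈ Finset.range d, jacRatio Q (2 * (m + 1) + j + 1)) * jacProd Q m *
    (∏ k ∈ Finset.range (m + 1), jacRatio Q (m + 1 + k)) * e4

theorem prod_eq_sum_partial_fractions {Q : ℂ} (hQ0 : Q ≠ 0) (hQ : ‖Q‖ < 1) (N : ℕ) {t : ℂ}
    (ht : ∀ k, t ≠ jacNode Q k) :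
    ∏ k ∈ Finset.range N, ((jacNode Q (k + 1) + t) / (jacNode Q (k + 1) - t))
      = jacProd Q N ^ 2 + ∑ n ∈ Finset.range N, 2 * (-1) ^ (n + 1) *
        (jacProd Q (N - (n + 1)) * jacProd Q (N + (n + 1))) *
        ((2 - t) / (jacNode Q (n + 1) - t)) := by
  classical
  set P : Polynomial ℂ := ∏ k ∈ Finset.range N, (Polynomial.X + Polynomial.C (jacNode Q (k + 1)))
    with hP
  have hev : ∀ x, P.eval x = ∏ k ∈ Finset.range N, (x + jacNode Q (k + 1)) := by
    intro x
    simp [hP, Polynomial.eval_prod]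
  have hdeg : P.degree < (Finset.range (N + 1)).card := by
    rw [hP, Polynomial.degree_prod]
    simp only [Polynomial.degree_X_add_C, Finset.sum_const, Finset.card_range, nsmul_eq_mul,
      mul_one]
    exact_mod_cast Nat.lt_succ_self N
  have hint := Lagrange.eq_interpolate (s := Finset.range (N + 1)) (v := jacNode Q)
    (jacNode_injective hQ0 hQ).injOn hdeg
  have h := congrArg (Polynomial.eval t) hint
  rw [Lagrange.eval_interpolate_not_at_node _ (fun i _ => ht i), Lagrange.eval_nodal, hev,
    Finset.prod_range_succ', Finset.sum_range_succ'] at h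
  simp only [hev] at h
  have h0 : jacNode Q 0 = 2 := by norm_num [jacNode]
  have ht0 : t - 2 ≠ 0 := sub_ne_zero.2 (h0 ▸ ht 0)
  have hs : (∑ k ∈ Finset.range N, Lagrange.nodalWeight (Finset.range (N + 1)) (jacNode Q) (k + 1)
      * (t - jacNode Q (k + 1))⁻¹ * ∏ x ∈ Finset.range N, (jacNode Q (k + 1) + jacNode Q (x + 1)))
      = ∑ n ∈ Finset.range N, (-1) ^ N * (2 * (-1) ^ (n + 1) *
        (jacProd Q (N - (n + 1)) * jacProd Q (N + (n + 1)))) * (t - jacNode Q (n + 1))⁻¹ := by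
    refine Finset.sum_congr rfl fun n hn => ?_
    rw [Finset.mem_range] at hn
    obtain ⟨d, rfl⟩ := Nat.exists_eq_add_of_lt hn
    have h2 := eval_mul_nodalWeight_succ hQ0 hQ n d
    rw [add_right_comm n d 1, mul_right_comm, h2, show n + 1 + d - (n + 1) = d by omega,
      show n + 1 + d + (n + 1) = 2 * (n + 1) + d by ring]
    have h3 : ((-1 : ℂ)) ^ (n + 1 + d) * (-1) ^ (n + 1) = (-1) ^ d := by
      rw [pow_add, mul_right_comm, ← mul_pow]; norm_num
    rw [← h3]; ring
  rw [hs, mul_right_comm _ (t - jacNode Q 0)⁻¹, eval_mul_nodalWeight_zero hQ0, h0] at h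
  rw [Finset.prod_div_distrib]
  have hsign : ∏ k ∈ Finset.range N, (jacNode Q (k + 1) - t)
      = (-1) ^ N * ∏ k ∈ Finset.range N, (t - jacNode Q (k + 1)) := by
    rw [← Finset.card_range N, ← Finset.prod_const, Finset.card_range, ← Finset.prod_mul_distrib]
    exact Finset.prod_congr rfl fun _ _ => by ring
  have hne : ∏ k ∈ Finset.range N, (t - jacNode Q (k + 1)) ≠ 0 :=
    Finset.prod_ne_zero_iff.2 fun k _ => sub_ne_zero.2 (ht _)
  have hsq : ((-1 : ℂ)) ^ N * (-1) ^ N = 1 := by rw [← mul_pow]; norm_num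
  have hsum : (t - 2) * ∑ n ∈ Finset.range N, (-1) ^ N * (2 * (-1) ^ (n + 1) *
        (jacProd Q (N - (n + 1)) * jacProd Q (N + (n + 1)))) * (t - jacNode Q (n + 1))⁻¹
      = (-1) ^ N * ∑ n ∈ Finset.range N, 2 * (-1) ^ (n + 1) *
        (jacProd Q (N - (n + 1)) * jacProd Q (N + (n + 1))) *
        ((2 - t) / (jacNode Q (n + 1) - t)) := by
    rw [Finset.mul_sum, Finset.mul_sum]
    refine Finset.sum_congr rfl fun n _ => ?_
    have := sub_ne_zero.2 (ht (n + 1))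
    rw [← neg_sub t 2, ← neg_sub t (jacNode Q (n + 1)), neg_div_neg_eq]
    ring
  rw [hsign, div_eq_iff (mul_ne_zero (pow_ne_zero _ (by norm_num)) hne)]
  simp only [add_comm _ t]
  rw [h, mul_assoc _ (t - 2), mul_add (t - 2), hsum, mul_comm _ (t - 2)⁻¹, ← mul_assoc (t - 2),
    mul_inv_cancel₀ ht0]
  ring
theorem summable_mul_pow {Q : ℂ} (hQ : ‖Q‖ < 1) (a : ℂ) : Summable fun n : ℕ => ‖-(a * Q ^ n)‖ := by
  simpa [norm_mul, norm_pow] using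
    (summable_geometric_of_lt_one (norm_nonneg Q) hQ).mul_left ‖a‖

theorem multipliable_poch {Q : ℂ} (hQ : ‖Q‖ < 1) (a : ℂ) :
    Multipliable fun n : ℕ => 1 - a * Q ^ n := by
  simpa [sub_eq_add_neg] using multipliable_one_add_of_summable (summable_mul_pow hQ a)

theorem tendsto_poch {Q : ℂ} (hQ : ‖Q‖ < 1) (a : ℂ) :
    Filter.Tendsto (fun N => ∏ k ∈ Finset.range N, (1 - a * Q ^ k)) Filter.atTop
      (nhds (poch a Q)) :=
  (multipliable_poch hQ a).hasProd.tendsto_prod_nat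

theorem poch_ne_zero {Q : ℂ} (hQ : ‖Q‖ < 1) {a : ℂ} (ha : ∀ n : ℕ, a * Q ^ n ≠ 1) :
    poch a Q ≠ 0 := by
  have h := tprod_one_add_ne_zero_of_summable (f := fun n : ℕ => -(a * Q ^ n))
    (fun n h => ha n (by linear_combination -h)) (summable_mul_pow hQ a)
  simpa only [poch, sub_eq_add_neg] using h

theorem poch_eq_mul_sq {Q : ℂ} (hQ : ‖Q‖ < 1) (a : ℂ) :
    poch a Q = poch a (Q ^ 2) * poch (a * Q) (Q ^ 2) := by
  have hQ2 : ‖Q ^ 2‖ < 1 := by rw [norm_pow]; exact pow_lt_one₀ (norm_nonneg _) hQ (by norm_num)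
  have h2 : Filter.Tendsto (fun N : ℕ => 2 * N) Filter.atTop Filter.atTop :=
    Filter.tendsto_id.const_mul_atTop' (by norm_num)
  refine tendsto_nhds_unique ((tendsto_poch hQ a).comp h2)
    (((tendsto_poch hQ2 a).mul (tendsto_poch hQ2 (a * Q))).congr fun N => ?_)
  induction N with
  | zero => simp
  | succ N ih =>
    rw [Finset.prod_range_succ, Finset.prod_range_succ, mul_mul_mul_comm, ih]
    simp only [Function.comp, mul_add, mul_one, Finset.prod_range_succ]
    ring

theorem poch_eq_mul_cube {Q : ℂ} (hQ : ‖Q‖ < 1) (a : ℂ) :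
    poch a Q = poch a (Q ^ 3) * poch (a * Q) (Q ^ 3) * poch (a * Q ^ 2) (Q ^ 3) := by
  have hQ2 : ‖Q ^ 3‖ < 1 := by rw [norm_pow]; exact pow_lt_one₀ (norm_nonneg _) hQ (by norm_num)
  have h2 : Filter.Tendsto (fun N : ℕ => 3 * N) Filter.atTop Filter.atTop :=
    Filter.tendsto_id.const_mul_atTop' (by norm_num)
  refine tendsto_nhds_unique ((tendsto_poch hQ a).comp h2)
    ((((tendsto_poch hQ2 a).mul (tendsto_poch hQ2 (a * Q))).mul
      (tendsto_poch hQ2 (a * Q ^ 2))).congr fun N => ?_)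
  induction N with
  | zero => simp
  | succ N ih =>
    simp only [Function.comp, mul_add, mul_one, Finset.prod_range_succ] at ih ⊢
    rw [← ih]
    ring

theorem poch_mul_poch_neg {Q : ℂ} (hQ : ‖Q‖ < 1) (a : ℂ) :
    poch a Q * poch (-a) Q = poch (a ^ 2) (Q ^ 2) := by
  rw [poch, poch, poch, ← (multipliable_poch hQ a).tprod_mul (multipliable_poch hQ (-a))]
  exact tprod_congr fun n => by ring

theorem poch_self_ne_zero {Q : ℂ} (hQ : ‖Q‖ < 1) : poch Q Q ≠ 0 :=
  poch_ne_zero hQ fun n h =>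
    one_sub_pow_ne_zero_of_norm_lt_one hQ (Nat.succ_ne_zero n) (by rw [pow_succ']; simp [h])

theorem poch_neg_self_ne_zero {Q : ℂ} (hQ : ‖Q‖ < 1) : poch (-Q) Q ≠ 0 :=
  poch_ne_zero hQ fun n h =>
    pow_ne_neg_one_of_norm_lt_one hQ (Nat.succ_ne_zero n) (by rw [pow_succ']; linear_combination -h)

theorem tendsto_jacProd {Q : ℂ} (hQ : ‖Q‖ < 1) :
    Filter.Tendsto (jacProd Q) Filter.atTop (nhds (poch (-Q) Q / poch Q Q)) := by
  refine ((tendsto_poch hQ (-Q)).div (tendsto_poch hQ Q) (poch_self_ne_zero hQ)).congr fun N => ?_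
  rw [Pi.div_apply, ← Finset.prod_div_distrib]
  exact Finset.prod_congr rfl fun k _ => by rw [jacRatio, pow_succ']; ring

theorem norm_mul_pow_div_le {Q y : ℂ} (hQ : ‖Q‖ < 1) (c : ℂ) :
    ∃ C, ∀ n : ℕ, ‖c * Q ^ (n + 1) / ((1 - y * Q ^ (n + 1)) * (1 - y⁻¹ * Q ^ (n + 1)))‖
      ≤ C * ‖Q‖ ^ n := by
  have hp : Filter.Tendsto (fun n : ℕ => Q ^ (n + 1)) Filter.atTop (nhds 0) :=
    (tendsto_pow_atTop_nhds_zero_of_norm_lt_one hQ).comp (Filter.tendsto_add_atTop_nat 1)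
  have h : Filter.Tendsto (fun n : ℕ => c * Q / ((1 - y * Q ^ (n + 1)) * (1 - y⁻¹ * Q ^ (n + 1))))
      Filter.atTop (nhds (c * Q / ((1 - y * 0) * (1 - y⁻¹ * 0)))) :=
    tendsto_const_nhds.div ((tendsto_const_nhds.sub (hp.const_mul y)).mul
      (tendsto_const_nhds.sub (hp.const_mul y⁻¹))) (by simp)
  obtain ⟨C, hC⟩ := isBounded_iff_forall_norm_le.1 (Metric.isBounded_range_of_tendsto _ h)
  refine ⟨C, fun n => ?_⟩
  have := hC _ ⟨n, rfl⟩
  calc _ = ‖c * Q / ((1 - y * Q ^ (n + 1)) * (1 - y⁻¹ * Q ^ (n + 1)))‖ * ‖Q‖ ^ n := by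
        rw [← norm_pow, ← norm_mul]; congr 1; rw [pow_succ]; ring
    _ ≤ _ := by gcongr

theorem jacNode_sub_node {Q y : ℂ} (hQ0 : Q ≠ 0) (hy0 : y ≠ 0) (k : ℕ) :
    jacNode Q k - (y + y⁻¹) = (Q ^ k)⁻¹ * ((1 - y * Q ^ k) * (1 - y⁻¹ * Q ^ k)) := by
  have := pow_ne_zero k hQ0
  rw [jacNode]
  field_simp
  ring

/-- The expansion of the elliptic function with a simple pole at `y = 1` and a zero at `y = -1`
as an alternating Lambert series. -/
theorem poch_quotient_eq_tsum {Q y : ℂ} (hQ0 : Q ≠ 0) (hQ : ‖Q‖ < 1) (hy0 : y ≠ 0)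
    (hy : ∀ k : ℕ, y * Q ^ k ≠ 1) (hy' : ∀ k : ℕ, y⁻¹ * Q ^ k ≠ 1) :
    poch (-(y * Q)) Q * poch (-(y⁻¹ * Q)) Q * poch Q Q ^ 2
        / (poch (y * Q) Q * poch (y⁻¹ * Q) Q * poch (-Q) Q ^ 2)
      = 1 + ∑' n : ℕ, 2 * (-1) ^ (n + 1) *
        ((2 - (y + y⁻¹)) * Q ^ (n + 1) / ((1 - y * Q ^ (n + 1)) * (1 - y⁻¹ * Q ^ (n + 1)))) := by
  set T : ℕ → ℂ := fun n =>
    (2 - (y + y⁻¹)) * Q ^ (n + 1) / ((1 - y * Q ^ (n + 1)) * (1 - y⁻¹ * Q ^ (n + 1))) with hT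
  set G := jacProd Q
  have hG := tendsto_jacProd hQ
  have hG0 : poch (-Q) Q / poch Q Q ≠ 0 :=
    div_ne_zero (poch_neg_self_ne_zero hQ) (poch_self_ne_zero hQ)
  have hGinv := hG.inv₀ hG0
  obtain ⟨B, hB⟩ := isBounded_iff_forall_norm_le.1 (Metric.isBounded_range_of_tendsto _ hG)
  obtain ⟨B', hB'⟩ := isBounded_iff_forall_norm_le.1 (Metric.isBounded_range_of_tendsto _ hGinv)
  have hB0 : 0 ≤ B := (norm_nonneg _).trans (hB _ ⟨0, rfl⟩)
  have hB0' : 0 ≤ B' := (norm_nonneg _).trans (hB' _ ⟨0, rfl⟩)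
  obtain ⟨C, hC⟩ := norm_mul_pow_div_le (y := y) hQ (2 - (y + y⁻¹))
  have hyk : ∀ k : ℕ, 1 - y * Q ^ k ≠ 0 := fun k h => hy k (by linear_combination -h)
  have hyk' : ∀ k : ℕ, 1 - y⁻¹ * Q ^ k ≠ 0 := fun k h => hy' k (by linear_combination -h)
  have ht : ∀ k, y + y⁻¹ ≠ jacNode Q k := by
    intro k h
    have h1 := jacNode_sub_node hQ0 hy0 k
    rw [← h, sub_self] at h1
    exact mul_ne_zero (inv_ne_zero (pow_ne_zero k hQ0)) (mul_ne_zero (hyk k) (hyk' k)) h1.symm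
  set F : ℕ → ℕ → ℂ := fun N n => if n < N then
    2 * (-1) ^ (n + 1) * (G (N - (n + 1)) * G (N + (n + 1)) * (G N)⁻¹ * (G N)⁻¹) * T n else 0
    with hF
  have hlim : Filter.Tendsto (fun N => ∑' n, F N n) Filter.atTop
      (nhds (∑' n, 2 * (-1) ^ (n + 1) * T n)) := by
    refine tendsto_tsum_of_dominated_convergence
      (bound := fun n => 2 * (B * B * B' * B') * (C * ‖Q‖ ^ n)) ?_ ?_ ?_
    · exact ((summable_geometric_of_lt_one (norm_nonneg Q) hQ).mul_left _).mul_left _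
    · intro n
      have h1 : Filter.Tendsto (fun N => 2 * (-1) ^ (n + 1) *
          (G (N - (n + 1)) * G (N + (n + 1)) * (G N)⁻¹ * (G N)⁻¹) * T n) Filter.atTop
          (nhds (2 * (-1) ^ (n + 1) * (poch (-Q) Q / poch Q Q * (poch (-Q) Q / poch Q Q)
            * (poch (-Q) Q / poch Q Q)⁻¹ * (poch (-Q) Q / poch Q Q)⁻¹) * T n)) :=
        (((((hG.comp (Filter.tendsto_sub_atTop_nat (n + 1))).mul
          (hG.comp (Filter.tendsto_add_atTop_nat (n + 1)))).mul hGinv).mul hGinv).const_mul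
            _).mul_const _
      have h2 : poch (-Q) Q / poch Q Q * (poch (-Q) Q / poch Q Q)
            * (poch (-Q) Q / poch Q Q)⁻¹ * (poch (-Q) Q / poch Q Q)⁻¹ = 1 := by
        rw [mul_inv_cancel_right₀ hG0, mul_inv_cancel₀ hG0]
      rw [h2, mul_one] at h1
      refine h1.congr' ?_
      filter_upwards [Filter.eventually_gt_atTop n] with N hN
      simp [hF, hN]
    · refine Filter.Eventually.of_forall fun N n => ?_
      by_cases hn : n < N
      · simp only [hF, hn, if_true, norm_mul, norm_pow, norm_neg, norm_one, one_pow, mul_one,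
          Complex.norm_ofNat]
        have a1 := hB _ ⟨N - (n + 1), rfl⟩
        have a2 := hB _ ⟨N + (n + 1), rfl⟩
        have a3 := hB' _ ⟨N, rfl⟩
        have a4 := hC n
        gcongr
      · simp only [hF, hn, if_false, norm_zero]
        have := (norm_nonneg _).trans (hC n)
        positivity
  have hsum : ∀ N, 1 + ∑' n, F N n = (∏ k ∈ Finset.range N,
      ((jacNode Q (k + 1) + (y + y⁻¹)) / (jacNode Q (k + 1) - (y + y⁻¹)))) * ((G N)⁻¹ * (G N)⁻¹) := by
    intro N
    have hGN : G N ≠ 0 := jacProd_ne_zero hQ N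
    rw [prod_eq_sum_partial_fractions hQ0 hQ N ht, add_mul,
      tsum_eq_sum (s := Finset.range N) (fun n hn => by
        rw [Finset.mem_range] at hn; simp [hF, hn]), Finset.sum_mul]
    congr 1
    · field_simp
      rfl
    · refine Finset.sum_congr rfl fun n hn => ?_
      rw [Finset.mem_range] at hn
      have h1 := pow_ne_zero (n + 1) hQ0
      have hTn : T n = (2 - (y + y⁻¹)) / (jacNode Q (n + 1) - (y + y⁻¹)) := by
        rw [hT, jacNode_sub_node hQ0 hy0, div_mul_eq_div_div, div_inv_eq_mul]
      simp only [hF, hn, if_true, ← hTn]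
      ring
  have hprod : ∀ k : ℕ, (jacNode Q (k + 1) + (y + y⁻¹)) / (jacNode Q (k + 1) - (y + y⁻¹))
      = (1 - (-(y * Q)) * Q ^ k) * (1 - (-(y⁻¹ * Q)) * Q ^ k)
        / ((1 - y * Q * Q ^ k) * (1 - y⁻¹ * Q * Q ^ k)) := by
    intro k
    have h1 := pow_ne_zero (k + 1) hQ0
    have h2 := jacNode_sub_node hQ0 (neg_ne_zero.2 hy0) (k + 1)
    have h3 : jacNode Q (k + 1) + (y + y⁻¹) = jacNode Q (k + 1) - (-y + (-y)⁻¹) := by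
      rw [inv_neg]; ring
    rw [h3, h2, jacNode_sub_node hQ0 hy0, mul_div_mul_left _ _ (inv_ne_zero h1), inv_neg, pow_succ']
    congr 1 <;> ring
  have hd : ∀ {z : ℂ}, (∀ k : ℕ, z * Q ^ k ≠ 1) → poch (z * Q) Q ≠ 0 := fun hz =>
    poch_ne_zero hQ fun n => by rw [mul_assoc, ← pow_succ']; exact hz _
  have hlim2 := (((tendsto_poch hQ (-(y * Q))).mul (tendsto_poch hQ (-(y⁻¹ * Q)))).div
    ((tendsto_poch hQ (y * Q)).mul (tendsto_poch hQ (y⁻¹ * Q)))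
    (mul_ne_zero (hd hy) (hd hy'))).mul (hGinv.mul hGinv)
  have hlim3 := (hlim.const_add 1).congr hsum
  have hlim4 := hlim3.congr fun N => by
    rw [Finset.prod_congr rfl fun k _ => hprod k, Finset.prod_div_distrib, Finset.prod_mul_distrib,
      Finset.prod_mul_distrib]
  rw [tendsto_nhds_unique hlim4 hlim2]
  have n1 := poch_self_ne_zero hQ
  have n2 := poch_neg_self_ne_zero hQ
  have n3 := hd hy
  have n4 := hd hy'
  field_simp
theorem norm_pow_lt_one {q : ℂ} (hq : ‖q‖ < 1) {k : ℕ} (hk : k ≠ 0) : ‖q ^ k‖ < 1 := by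
  rw [norm_pow]; exact pow_lt_one₀ (norm_nonneg _) hq hk

theorem poch_eq_one_sub_mul {Q : ℂ} (hQ : ‖Q‖ < 1) (a : ℂ) :
    poch a Q = (1 - a) * poch (a * Q) Q := by
  refine tendsto_nhds_unique ((tendsto_poch hQ a).comp (Filter.tendsto_add_atTop_nat 1))
    (((tendsto_poch hQ (a * Q)).const_mul (1 - a)).congr fun N => ?_)
  rw [Function.comp_apply, Finset.prod_range_succ', pow_zero, mul_one, mul_comm]
  congr 1
  exact Finset.prod_congr rfl fun k _ => by ring

theorem poch_mul_cube_roots {Q w : ℂ} (hQ : ‖Q‖ < 1) (hw : 1 + w + w ^ 2 = 0) (a : ℂ) :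
    poch a Q * poch (w * a) Q * poch (w ^ 2 * a) Q = poch (a ^ 3) (Q ^ 3) := by
  rw [poch, poch, poch, poch,
    ← (multipliable_poch hQ a).tprod_mul (multipliable_poch hQ (w * a)),
    ← ((multipliable_poch hQ a).mul (multipliable_poch hQ (w * a))).tprod_mul
      (multipliable_poch hQ (w ^ 2 * a))]
  refine tprod_congr fun n => ?_
  have hw3 : w ^ 3 = 1 := by linear_combination (w - 1) * hw
  rw [← pow_mul, mul_comm 3 n, pow_mul, ← mul_pow, mul_assoc w, mul_assoc (w ^ 2)]
  generalize a * Q ^ n = z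
  linear_combination (-z + w * z ^ 2) * hw + (-z ^ 3) * hw3

theorem poch_pow_ne_zero {q : ℂ} (hq : ‖q‖ < 1) {r m : ℕ} (hr : r ≠ 0) (hm : m ≠ 0) :
    poch (q ^ r) (q ^ m) ≠ 0 :=
  poch_ne_zero (norm_pow_lt_one hq hm) fun n h =>
    one_sub_pow_ne_zero_of_norm_lt_one hq (k := r + m * n) (by omega)
      (by rw [pow_add, pow_mul, h, sub_self])

theorem poch_neg_self_mul {Q : ℂ} (hQ : ‖Q‖ < 1) : poch (-Q) Q * poch Q (Q ^ 2) = 1 := by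
  have h1 := poch_mul_poch_neg hQ Q
  have h2 := poch_eq_mul_sq hQ Q
  have h3 : poch (Q ^ 2) (Q ^ 2) ≠ 0 := poch_pow_ne_zero hQ two_ne_zero two_ne_zero
  rw [h2, ← pow_two] at h1
  exact mul_right_cancel₀ h3 (by linear_combination h1)

noncomputable def lambertTerm (q : ℂ) (m : ℕ) : ℂ := q ^ m / (1 - q ^ m)

theorem summable_lambertTerm {q : ℂ} (hq : ‖q‖ < 1) : Summable (lambertTerm q) := by
  have hp := tendsto_pow_atTop_nhds_zero_of_norm_lt_one hq
  have h : Filter.Tendsto (fun n : ℕ => (1 - q ^ n)⁻¹) Filter.atTop (nhds (1 - 0)⁻¹) :=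
    (tendsto_const_nhds.sub hp).inv₀ (by simp)
  obtain ⟨C, hC⟩ := isBounded_iff_forall_norm_le.1 (Metric.isBounded_range_of_tendsto _ h)
  refine Summable.of_norm_bounded
    ((summable_geometric_of_lt_one (norm_nonneg q) hq).mul_right C) fun n => ?_
  rw [lambertTerm, div_eq_mul_inv, norm_mul, norm_pow]
  have := hC _ ⟨n, rfl⟩
  gcongr

theorem summable_lambertTerm_linear {q : ℂ} (hq : ‖q‖ < 1) {a : ℕ} (ha : a ≠ 0) (b : ℕ) :
    Summable fun n => lambertTerm q (a * n + b) :=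
  (summable_lambertTerm hq).comp_injective fun m n h => by
    have : a * m = a * n := by simpa using h
    exact Nat.eq_of_mul_eq_mul_left (Nat.pos_of_ne_zero ha) this

theorem Sser_self_cube {q : ℂ} (hq0 : q ≠ 0) (hq : ‖q‖ < 1) :
    Sser q (q ^ 3) = ∑' n, (lambertTerm q (3 * n + 1) - lambertTerm q (3 * n + 2)) := by
  refine tsum_congr fun n => ?_
  have h1 := one_sub_pow_ne_zero_of_norm_lt_one hq (k := 3 * n + 1) (by omega)
  have h2 := one_sub_pow_ne_zero_of_norm_lt_one hq (k := 3 * n + 2) (by omega)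
  have e1 : q * (q ^ 3) ^ n = q ^ (3 * n + 1) := by rw [← pow_mul, pow_succ']
  have e2 : q⁻¹ * (q ^ 3) ^ (n + 1) = q ^ (3 * n + 2) := by
    rw [← pow_mul, show 3 * (n + 1) = 3 * n + 2 + 1 by ring, pow_succ', inv_mul_cancel_left₀ hq0]
  rw [e1, e2, lambertTerm, lambertTerm]
  field_simp
  ring

theorem neg_pow_lambert {q : ℂ} (hq : ‖q‖ < 1) {m : ℕ} (hm : m ≠ 0) :
    HasSum (fun n : ℕ => (-1) ^ (n + 1) * (q ^ m) ^ (n + 1))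
      (2 * lambertTerm q (2 * m) - lambertTerm q m) := by
  have h := (hasSum_geometric_of_norm_lt_one (ξ := -q ^ m)
    (by rw [norm_neg]; exact norm_pow_lt_one hq hm)).mul_left (-q ^ m)
  have h2 := one_sub_pow_ne_zero_of_norm_lt_one hq hm
  have h3 := one_sub_pow_ne_zero_of_norm_lt_one hq (k := 2 * m) (by omega)
  have hv : -q ^ m * (1 - -q ^ m)⁻¹ = 2 * lambertTerm q (2 * m) - lambertTerm q m := by
    rw [lambertTerm, lambertTerm, sub_neg_eq_add]
    rw [show q ^ (2 * m) = q ^ m * q ^ m by rw [two_mul, pow_add]] at h3 ⊢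
    generalize q ^ m = x at *
    have hfac : 1 - x * x = (1 - x) * (1 + x) := by ring
    have h1' : 1 + x ≠ 0 := right_ne_zero_of_mul (hfac ▸ h3)
    rw [hfac]
    field_simp
    ring
  have hfun : (fun n : ℕ => (-1) ^ (n + 1) * (q ^ m) ^ (n + 1))
      = fun n : ℕ => -q ^ m * (-q ^ m) ^ n := funext fun n => by
    rw [← mul_pow, pow_succ']
    ring
  rw [hfun, ← hv]
  exact h

theorem alternating_cubic_lambert {q : ℂ} (hq : ‖q‖ < 1) :
    ∑' n : ℕ, (-1) ^ (n + 1) * (q ^ (n + 1) / (1 + q ^ (n + 1) + (q ^ (n + 1)) ^ 2))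
      = ∑' k : ℕ, ((2 * lambertTerm q (6 * k + 2) - lambertTerm q (3 * k + 1))
        - (2 * lambertTerm q (6 * k + 4) - lambertTerm q (3 * k + 2))) := by
  set f : ℕ → ℕ → ℂ := fun n k =>
    (-1) ^ (n + 1) * ((q ^ (3 * k + 1)) ^ (n + 1) - (q ^ (3 * k + 2)) ^ (n + 1)) with hf
  have hsum : Summable (Function.uncurry f) := by
    have hg := summable_geometric_of_lt_one (norm_nonneg q) hq
    refine Summable.of_norm_bounded
      ((hg.mul_of_nonneg hg (fun n => by positivity) (fun n => by positivity)).mul_left 2) ?_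
    rintro ⟨n, k⟩
    have hle : ∀ j : ℕ, n + k ≤ j → ‖q‖ ^ j ≤ ‖q‖ ^ n * ‖q‖ ^ k := fun j hj => by
      rw [← pow_add]; exact pow_le_pow_of_le_one (norm_nonneg q) hq.le hj
    simp only [Function.uncurry, hf, norm_mul, norm_pow, norm_neg, norm_one, one_pow, one_mul,
      ← pow_mul]
    refine (norm_sub_le _ _).trans ?_
    rw [norm_pow, norm_pow]
    have a1 := hle ((3 * k + 1) * (n + 1)) (by nlinarith [Nat.zero_le (n * k)])
    have a2 := hle ((3 * k + 2) * (n + 1)) (by nlinarith [Nat.zero_le (n * k)])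
    linarith
  have hrow : ∀ n, ∑' k, f n k
      = (-1) ^ (n + 1) * (q ^ (n + 1) / (1 + q ^ (n + 1) + (q ^ (n + 1)) ^ 2)) := by
    intro n
    have hx := norm_pow_lt_one hq (Nat.succ_ne_zero n)
    have hx1 := one_sub_pow_ne_zero_of_norm_lt_one hq (Nat.succ_ne_zero n)
    have e : ∀ k, f n k = (-1) ^ (n + 1) * (q ^ (n + 1) - (q ^ (n + 1)) ^ 2)
        * ((q ^ (n + 1)) ^ 3) ^ k := fun k => by simp only [hf]; ring
    rw [Nat.succ_eq_add_one] at hx hx1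
    have hx3 := one_sub_pow_ne_zero_of_norm_lt_one hx three_ne_zero
    rw [tsum_congr e, tsum_mul_left, tsum_geometric_of_norm_lt_one (norm_pow_lt_one hx three_ne_zero),
      mul_assoc]
    generalize q ^ (n + 1) = x at *
    have hfac : 1 - x ^ 3 = (1 - x) * (1 + x + x ^ 2) := by ring
    rw [hfac] at hx3 ⊢
    have := right_ne_zero_of_mul hx3
    field_simp
  have hcol : ∀ k, ∑' n, f n k = (2 * lambertTerm q (6 * k + 2) - lambertTerm q (3 * k + 1))
        - (2 * lambertTerm q (6 * k + 4) - lambertTerm q (3 * k + 2)) := by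
    intro k
    have h := (neg_pow_lambert hq (m := 3 * k + 1) (by omega)).sub
      (neg_pow_lambert hq (m := 3 * k + 2) (by omega))
    rw [show 2 * (3 * k + 1) = 6 * k + 2 by ring, show 2 * (3 * k + 2) = 6 * k + 4 by ring] at h
    rw [← h.tsum_eq]
    exact tsum_congr fun n => by simp only [hf]; ring
  rw [← tsum_congr hrow, ← tsum_congr hcol, hsum.tsum_comm]

theorem alternating_lambert_sub {q : ℂ} (hq : ‖q‖ < 1) :
    (∑' n : ℕ, (-1) ^ n * (lambertTerm q (3 * n + 1) + lambertTerm q (3 * n + 2)))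
      - ∑' n : ℕ, (-1) ^ (n + 1) * (q ^ (n + 1) / (1 + q ^ (n + 1) + (q ^ (n + 1)) ^ 2))
      = 2 * ∑' n, (lambertTerm q (3 * n + 1) - lambertTerm q (3 * n + 2)) := by
  set u := lambertTerm q
  have hs : ∀ {a : ℕ} (ha : a ≠ 0) (b : ℕ), Summable fun n => u (a * n + b) :=
    fun ha b => summable_lambertTerm_linear hq ha b
  have s1 := hs three_ne_zero 1
  have s2 := hs three_ne_zero 2
  have t1 := hs (a := 6) (by norm_num) 2
  have t2 := hs (a := 6) (by norm_num) 4
  have hsplit : (∑' n : ℕ, (-1) ^ n * (u (3 * n + 1) + u (3 * n + 2)))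
      = (∑' n, (u (3 * n + 1) - u (3 * n + 2))) + ∑' n, (2 * u (6 * n + 2) - 2 * u (6 * n + 4)) := by
    set h : ℕ → ℂ := fun n => (-1) ^ n * (u (3 * n + 1) + u (3 * n + 2))
      - (u (3 * n + 1) - u (3 * n + 2)) with hh
    have he : ∀ n, h (2 * n) = 2 * u (6 * n + 2) := fun n => by
      simp only [hh, pow_mul, neg_one_sq, one_pow, ← mul_assoc]
      norm_num
      ring
    have ho : ∀ n, h (2 * n + 1) = -(2 * u (6 * n + 4)) := fun n => by
      simp only [hh, pow_succ, pow_mul, mul_neg_one, neg_neg,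
        show 3 * (2 * n + 1) + 1 = 6 * n + 4 by ring]
      ring
    have se : Summable fun n => h (2 * n) := (t1.mul_left 2).congr fun n => (he n).symm
    have so : Summable fun n => h (2 * n + 1) := (t2.mul_left 2).neg.congr fun n => (ho n).symm
    have hsum : Summable h := (se.hasSum.even_add_odd so.hasSum).summable
    have e := tsum_even_add_odd se so
    rw [tsum_congr he, tsum_congr ho, tsum_neg, ← sub_eq_add_neg,
      ← (t1.mul_left 2).tsum_sub (t2.mul_left 2)] at e
    rw [e, ← (s1.sub s2).tsum_add hsum]
    exact tsum_congr fun n => by simp only [hh]; ring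
  rw [alternating_cubic_lambert hq, hsplit, ← (s1.sub s2).tsum_add ((t1.mul_left 2).sub
    (t2.mul_left 2)), ← Summable.tsum_sub, ← tsum_mul_left]
  · exact tsum_congr fun n => by ring
  · exact (s1.sub s2).add ((t1.mul_left 2).sub (t2.mul_left 2))
  · exact ((t1.mul_left 2).sub s1).sub ((t2.mul_left 2).sub s2)
theorem poch_self_eq {q : ℂ} (hq : ‖q‖ < 1) :
    poch q (q ^ 2) = poch (q ^ 1) (q ^ 6) * poch (q ^ 3) (q ^ 6) * poch (q ^ 5) (q ^ 6) := by
  rw [poch_eq_mul_cube (norm_pow_lt_one hq two_ne_zero)]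
  simp only [← pow_succ', ← pow_mul, pow_one]

theorem poch_sq_sq_eq {q : ℂ} (hq : ‖q‖ < 1) :
    poch (q ^ 2) (q ^ 2) = poch (q ^ 2) (q ^ 6) * poch (q ^ 4) (q ^ 6) * poch (q ^ 6) (q ^ 6) := by
  rw [poch_eq_mul_cube (norm_pow_lt_one hq two_ne_zero)]
  simp only [← pow_add, ← pow_mul]

theorem poch_pow_cube_eq {q : ℂ} (hq : ‖q‖ < 1) (r : ℕ) :
    poch (q ^ r) (q ^ 3) = poch (q ^ r) (q ^ 6) * poch (q ^ (r + 3)) (q ^ 6) := by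
  rw [poch_eq_mul_sq (norm_pow_lt_one hq three_ne_zero)]
  simp only [← pow_add, ← pow_mul]

theorem cubic_quotient_algebra {P N R R' a b a' b' p1 p2 p3 p4 p5 p6 : ℂ}
    (hN : N ≠ 0) (h3 : p3 ≠ 0) (h6 : p6 ≠ 0) (c1 : P * a * b = R) (c2 : N * a' * b' = R')
    (e1 : N * (p1 * p3 * p5) = 1) (e2 : R' * p3 = 1)
    (e3 : P = p1 * p3 * p5 * (p2 * p4 * p6)) (e4 : R = p3 * p6) :
    a' * b' * P ^ 2 / (a * b * N ^ 2)
      = p1 ^ 6 * p5 ^ 6 * p2 ^ 3 * p4 ^ 3 * p3 ^ 4 * p6 ^ 2 := by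
  have hP : P ≠ 0 := by
    rintro rfl
    exact mul_ne_zero h3 h6 (by rw [← e4, ← c1]; ring)
  have h135 : p1 * p3 * p5 = N⁻¹ := eq_inv_of_mul_eq_one_right e1
  have hab : a * b = p3 * p6 / P := by rw [eq_div_iff hP, ← e4, ← c1]; ring
  have hab' : a' * b' = p3⁻¹ / N := by
    rw [eq_div_iff hN, ← eq_inv_of_mul_eq_one_left e2, ← c2]; ring
  rw [hab, hab']
  have hgoal : p3⁻¹ / N * P ^ 2 / (p3 * p6 / P * N ^ 2) = P ^ 3 * N⁻¹ ^ 3 / (p3 ^ 2 * p6) := by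
    field_simp
  rw [hgoal, ← h135, e3]
  field_simp

theorem alternating_cubic_lambert_eq_poch {q : ℂ} (hq0 : q ≠ 0) (hq : ‖q‖ < 1) :
    1 + 6 * ∑' n : ℕ, (-1) ^ (n + 1) * (q ^ (n + 1) / (1 + q ^ (n + 1) + (q ^ (n + 1)) ^ 2))
      = poch (q ^ 1) (q ^ 6) ^ 6 * poch (q ^ 5) (q ^ 6) ^ 6 * poch (q ^ 2) (q ^ 6) ^ 3
        * poch (q ^ 4) (q ^ 6) ^ 3 * poch (q ^ 3) (q ^ 6) ^ 4 * poch (q ^ 6) (q ^ 6) ^ 2 := by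
  obtain ⟨w, hprim⟩ : ∃ w : ℂ, IsPrimitiveRoot w 3 :=
    ⟨_, Complex.isPrimitiveRoot_exp 3 (by norm_num)⟩
  have hw : 1 + w + w ^ 2 = 0 := by
    simpa [Finset.sum_range_succ] using hprim.geom_sum_eq_zero (by norm_num)
  have hw3 : w ^ 3 = 1 := by linear_combination (w - 1) * hw
  have hw0 : w ≠ 0 := by rintro rfl; norm_num at hw
  have hwi : w⁻¹ = w ^ 2 := inv_eq_of_mul_eq_one_right (by linear_combination hw3)
  have hcube : ∀ {z : ℂ}, z ^ 3 = 1 → z ≠ 1 → ∀ k : ℕ, z * q ^ k ≠ 1 := by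
    intro z hz hz1 k h
    rcases eq_or_ne k 0 with rfl | hk
    · exact hz1 (by simpa using h)
    · refine one_sub_pow_ne_zero_of_norm_lt_one hq (k := k * 3) (by omega) ?_
      have := congrArg (· ^ 3) h
      simp only [mul_pow, hz, one_mul, one_pow] at this
      rw [pow_mul, this, sub_self]
  have hw1 : w ≠ 1 := by rintro rfl; norm_num at hw
  have hw2 : w ^ 2 ≠ 1 := fun h => hw1 (by rw [← hw3, pow_succ, h, one_mul])
  have h := poch_quotient_eq_tsum hq0 hq hw0 (hcube hw3 hw1)
    (hcube (by rw [hwi]; linear_combination (w ^ 3 + 1) * hw3) (hwi ▸ hw2))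
  have hterm : ∀ n : ℕ, 2 * (-1) ^ (n + 1) * ((2 - (w + w⁻¹)) * q ^ (n + 1) /
      ((1 - w * q ^ (n + 1)) * (1 - w⁻¹ * q ^ (n + 1))))
      = 6 * ((-1) ^ (n + 1) * (q ^ (n + 1) / (1 + q ^ (n + 1) + (q ^ (n + 1)) ^ 2))) := by
    intro n
    rw [hwi, show 2 - (w + w ^ 2) = 3 by linear_combination -hw]
    have : (1 - w * q ^ (n + 1)) * (1 - w ^ 2 * q ^ (n + 1))
        = 1 + q ^ (n + 1) + (q ^ (n + 1)) ^ 2 := by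
      linear_combination (-q ^ (n + 1)) * hw + (q ^ (n + 1)) ^ 2 * hw3
    rw [this]
    ring
  rw [tsum_congr hterm, tsum_mul_left] at h
  rw [← h, hwi]
  have c1 := poch_mul_cube_roots hq hw q
  have c2 := poch_mul_cube_roots hq hw (-q)
  rw [show (-q) ^ 3 = -q ^ 3 by ring, mul_neg, mul_neg] at c2
  have hq3 := norm_pow_lt_one hq three_ne_zero
  have e1 := poch_neg_self_mul hq
  have e2 := poch_neg_self_mul hq3
  rw [poch_self_eq hq] at e1
  rw [← pow_mul] at e2
  have e3 := poch_eq_mul_sq hq q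
  rw [poch_self_eq hq, ← pow_two, poch_sq_sq_eq hq] at e3
  have e4 := poch_pow_cube_eq hq 3
  have nz : ∀ r : ℕ, r ≠ 0 → poch (q ^ r) (q ^ 6) ≠ 0 := fun r hr =>
    poch_pow_ne_zero hq hr (by norm_num)
  exact cubic_quotient_algebra (poch_neg_self_ne_zero hq) (nz 3 (by norm_num)) (nz 6 (by norm_num))
    c1 c2 e1 e2 e3 e4

theorem lambert_partial_fraction {q x s : ℂ} (hq0 : q ≠ 0) (h1 : 1 - x ≠ 0)
    (h2 : 1 - q ^ 2 * x ≠ 0) :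
    (1 + q) / (1 - q) * (2 * (s * -1) * ((2 - (q + q⁻¹)) * (q * x) /
      ((1 - q ^ 2 * x) * (1 - x))))
      = 2 * (s * -1 * (q ^ 2 * x / (1 - q ^ 2 * x)) + s * (x / (1 - x))) := by
  have e : (2 - (q + q⁻¹)) * (q * x) = -((1 - q) ^ 2 * x) := by
    field_simp
    ring
  rw [e]
  field_simp
  ring

theorem summable_alternating_lambertTerm {q : ℂ} (hq : ‖q‖ < 1) (b : ℕ) :
    Summable fun n : ℕ => (-1) ^ n * lambertTerm q (3 * n + b) :=
  Summable.of_norm (by simpa using (summable_lambertTerm_linear hq three_ne_zero b).norm)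

theorem alternating_lambert_shift {q : ℂ} (hq : ‖q‖ < 1) :
    ∑' n : ℕ, (-1) ^ n * (lambertTerm q (3 * n + 1) + lambertTerm q (3 * n + 2))
      = lambertTerm q 1 + ∑' n : ℕ, ((-1) ^ (n + 1) * lambertTerm q (3 * (n + 1) + 1)
        + (-1) ^ n * lambertTerm q (3 * n + 2)) := by
  have s1 := summable_alternating_lambertTerm hq 1
  have s2 := summable_alternating_lambertTerm hq 2
  have s1' := (summable_nat_add_iff 1).2 s1
  have e1 := s1.tsum_eq_zero_add
  have e2 := s1'.tsum_add s2
  simp only [mul_add (_ ^ _)]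
  rw [s1.tsum_add s2, e1, e2]
  simp [add_assoc]

theorem mul_pow_cube_eq (q : ℂ) (k : ℕ) : q * (q ^ 3) ^ k = q ^ (3 * k + 1) := by
  rw [← pow_mul, pow_succ']

theorem inv_mul_pow_cube_eq {q : ℂ} (hq0 : q ≠ 0) (k : ℕ) :
    q⁻¹ * (q ^ 3) ^ (k + 1) = q ^ (3 * k + 2) := by
  rw [← pow_mul, show 3 * (k + 1) = 3 * k + 2 + 1 by ring, pow_succ', inv_mul_cancel_left₀ hq0]

theorem alternating_lambert_eq_tsum {q : ℂ} (hq0 : q ≠ 0) (hq : ‖q‖ < 1) :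
    1 + 2 * ∑' n : ℕ, (-1) ^ n * (lambertTerm q (3 * n + 1) + lambertTerm q (3 * n + 2))
      = (1 + q) / (1 - q) * (1 + ∑' n : ℕ, 2 * (-1) ^ (n + 1) * ((2 - (q + q⁻¹)) *
      (q ^ 3) ^ (n + 1) / ((1 - q * (q ^ 3) ^ (n + 1)) * (1 - q⁻¹ * (q ^ 3) ^ (n + 1))))) := by
  have hq1 : 1 - q ≠ 0 := by simpa using one_sub_pow_ne_zero_of_norm_lt_one hq one_ne_zero
  have hterm : ∀ n : ℕ, (1 + q) / (1 - q) * (2 * (-1) ^ (n + 1) * ((2 - (q + q⁻¹)) *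
      (q ^ 3) ^ (n + 1) / ((1 - q * (q ^ 3) ^ (n + 1)) * (1 - q⁻¹ * (q ^ 3) ^ (n + 1)))))
      = 2 * ((-1) ^ (n + 1) * lambertTerm q (3 * (n + 1) + 1)
        + (-1) ^ n * lambertTerm q (3 * n + 2)) := by
    intro n
    have h1 := one_sub_pow_ne_zero_of_norm_lt_one hq (k := 3 * n + 2) (by omega)
    have h2 := one_sub_pow_ne_zero_of_norm_lt_one hq (k := 3 * (n + 1) + 1) (by omega)
    have e1 : (q ^ 3) ^ (n + 1) = q * q ^ (3 * n + 2) := by rw [← pow_mul, ← pow_succ']; rfl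
    have e2 : q ^ (3 * (n + 1) + 1) = q ^ 2 * q ^ (3 * n + 2) := by
      rw [← pow_add]; congr 1; ring
    rw [e2] at h2
    rw [inv_mul_pow_cube_eq hq0, mul_pow_cube_eq, lambertTerm, lambertTerm, e1, e2,
      pow_succ (-1 : ℂ)]
    exact lambert_partial_fraction hq0 h1 h2
  have hu1 : (1 + q) / (1 - q) = 1 + 2 * lambertTerm q 1 := by
    rw [lambertTerm, pow_one]
    field_simp
    ring
  have hsum := tsum_congr (L := .unconditional ℕ) hterm
  rw [tsum_mul_left, tsum_mul_left] at hsum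
  rw [mul_add, mul_one, hsum, alternating_lambert_shift hq, hu1]
  ring

theorem base_cube_quotient_algebra {q N R R' s a b a' b' g p1 p2 p3 p4 p5 p6 : ℂ}
    (ha : a ≠ 0) (hb : b ≠ 0) (hR' : R' ≠ 0) (h1 : p1 ≠ 0) (h2 : p2 ≠ 0) (h3 : p3 ≠ 0)
    (h4 : p4 ≠ 0) (h5 : p5 ≠ 0) (e1 : N * (p1 * p3 * p5) = 1) (e2 : R' * p3 = 1)
    (e3 : N = g * b' * R') (e4 : s = (1 - q) * a) (e5 : g = (1 + q) * a')
    (f1 : s = p1 * p4) (f2 : b = p2 * p5) (f3 : R = p3 * p6) :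
    (1 + q) / (1 - q) * (a' * b' * R ^ 2 / (a * b * R' ^ 2))
      = p3 ^ 4 * p6 ^ 2 / (p1 ^ 2 * p5 ^ 2 * p2 * p4) := by
  have hr : R' = p3⁻¹ := eq_inv_of_mul_eq_one_left e2
  have hl : (1 + q) / (1 - q) * (a' * b' * R ^ 2 / (a * b * R' ^ 2))
      = ((1 + q) * a' * b' * R') * R ^ 2 / ((1 - q) * a * b * R' ^ 3) := by
    field_simp
  rw [hl, ← e5, ← e4, ← e3, f1, f2, f3, hr, eq_inv_of_mul_eq_one_left e1]
  field_simp

theorem alternating_lambert_eq_poch {q : ℂ} (hq0 : q ≠ 0) (hq : ‖q‖ < 1) :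
    1 + 2 * ∑' n : ℕ, (-1) ^ n * (lambertTerm q (3 * n + 1) + lambertTerm q (3 * n + 2))
      = poch (q ^ 3) (q ^ 6) ^ 4 * poch (q ^ 6) (q ^ 6) ^ 2 / (poch (q ^ 1) (q ^ 6) ^ 2
        * poch (q ^ 5) (q ^ 6) ^ 2 * poch (q ^ 2) (q ^ 6) * poch (q ^ 4) (q ^ 6)) := by
  have hq3 := norm_pow_lt_one hq three_ne_zero
  have hne : ∀ k : ℕ, k ≠ 0 → q ^ k ≠ 1 := fun k hk h =>
    one_sub_pow_ne_zero_of_norm_lt_one hq hk (by rw [h, sub_self])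
  have h := poch_quotient_eq_tsum (y := q) (pow_ne_zero 3 hq0) hq3 hq0
    (fun k => by rw [mul_pow_cube_eq]; exact hne _ (by omega))
    (fun k => by
      rcases k with _ | k
      · rw [pow_zero, mul_one]
        exact fun h => hne 1 one_ne_zero (by rw [pow_one, ← inv_inv q, h, inv_one])
      · rw [inv_mul_pow_cube_eq hq0]; exact hne _ (by omega))
  have hq1 : 1 - q ≠ 0 := by simpa using one_sub_pow_ne_zero_of_norm_lt_one hq one_ne_zero
  have hinv : q⁻¹ * q ^ 3 = q ^ 2 := by simpa using inv_mul_pow_cube_eq hq0 0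
  rw [alternating_lambert_eq_tsum hq0 hq, ← h, hinv]
  have e1 := poch_neg_self_mul hq
  have e2 := poch_neg_self_mul hq3
  rw [poch_self_eq hq] at e1
  rw [← pow_mul] at e2
  have e3 := poch_eq_mul_cube hq (-q)
  rw [show -q * q = -q ^ 2 by ring, show -q * q ^ 2 = -q ^ 3 by ring] at e3
  have e4 := poch_eq_one_sub_mul hq3 q
  have e5 := poch_eq_one_sub_mul hq3 (-q)
  rw [sub_neg_eq_add, neg_mul] at e5
  have f1 := poch_pow_cube_eq hq 1
  rw [pow_one] at f1
  have nz : ∀ r : ℕ, r ≠ 0 → poch (q ^ r) (q ^ 6) ≠ 0 := fun r hr =>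
    poch_pow_ne_zero hq hr (by norm_num)
  have n1 : poch q (q ^ 3) ≠ 0 := by
    simpa using poch_pow_ne_zero hq one_ne_zero three_ne_zero
  rw [e4] at n1
  exact base_cube_quotient_algebra (right_ne_zero_of_mul n1)
    (poch_pow_ne_zero hq two_ne_zero three_ne_zero) (poch_neg_self_ne_zero hq3)
    (nz 1 (by norm_num)) (nz 2 (by norm_num)) (nz 3 (by norm_num)) (nz 4 (by norm_num))
    (nz 5 (by norm_num)) e1 e2 e3 e4 e5 (by simpa using f1) (poch_pow_cube_eq hq 2)
    (poch_pow_cube_eq hq 3)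

theorem stmt11 (q : ℂ) (hq0 : 0 < ‖q‖) (hq : ‖q‖ < 1)
    (hden : ∀ m : ℤ, m ≠ 0 → q ^ m ≠ 1) :
    1 + 6 * Sser q (q ^ 3)
      = 3 * (Jam 3 6 q) ^ 2 * (Jm 6 q) ^ 3 / (2 * (Jam 1 6 q) ^ 2 * Jm 2 q)
        - (Jam 1 6 q) ^ 6 * (Jm 2 q) ^ 3 * (Jam 3 6 q) ^ 2 / (2 * (Jm 6 q) ^ 9) := by
  have hq0' : q ≠ 0 := norm_pos_iff.1 hq0
  have hA := alternating_cubic_lambert_eq_poch hq0' hq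
  have hB := alternating_lambert_eq_poch hq0' hq
  have hAB := alternating_lambert_sub hq
  have nz : ∀ r : ℕ, r ≠ 0 → poch (q ^ r) (q ^ 6) ≠ 0 := fun r hr =>
    poch_pow_ne_zero hq hr (by norm_num)
  have n1 := nz 1 (by norm_num)
  have n2 := nz 2 (by norm_num)
  have n3 := nz 3 (by norm_num)
  have n4 := nz 4 (by norm_num)
  have n5 := nz 5 (by norm_num)
  have n6 := nz 6 (by norm_num)
  simp only [Jam, Jm, poch_sq_sq_eq hq, show 6 - 3 = 3 from rfl, show 6 - 1 = 5 from rfl]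
  rw [Sser_self_cube hq0' hq]
  generalize poch (q ^ 1) (q ^ 6) = p1 at *
  generalize poch (q ^ 2) (q ^ 6) = p2 at *
  generalize poch (q ^ 3) (q ^ 6) = p3 at *
  generalize poch (q ^ 4) (q ^ 6) = p4 at *
  generalize poch (q ^ 5) (q ^ 6) = p5 at *
  generalize poch (q ^ 6) (q ^ 6) = p6 at *
  have t1 : 3 * (p3 * p3 * p6) ^ 2 * p6 ^ 3 / (2 * (p1 * p5 * p6) ^ 2 * (p2 * p4 * p6))
      = 3 / 2 * (p3 ^ 4 * p6 ^ 2 / (p1 ^ 2 * p5 ^ 2 * p2 * p4)) := by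
    field_simp
  have t2 : (p1 * p5 * p6) ^ 6 * (p2 * p4 * p6) ^ 3 * (p3 * p3 * p6) ^ 2 / (2 * p6 ^ 9)
      = 1 / 2 * (p1 ^ 6 * p5 ^ 6 * p2 ^ 3 * p4 ^ 3 * p3 ^ 4 * p6 ^ 2) := by
    field_simp
  rw [t1, t2, ← hA, ← hB]
  linear_combination (-3) * hAB
end

section
/- For |q|<1 and a,b,c ∈ ℂ* such that none of a, b, c, abc is an integral power of q, the identity [ab]_∞[bc]_∞[ca]_∞ (q;q)_∞² / ([a]_∞[b]_∞[c]_∞[abc]_∞) = 1 + Σ_{n≥0} aq^n/(1-aq^n) − Σ_{n≥1} (q^n/a)/(1-q^n/a) + Σ_{n≥0} bq^n/(1-bq^n) − Σ_{n≥1} (q^n/b)/(1-q^n/b) + Σ_{n≥0} cq^n/(1-cq^n) − Σ_{n≥1} (q^n/c)/(1-q^n/c) − Σ_{n≥0} abcq^n/(1-abcq^n) + Σ_{n≥1} (q^n/abc)/(1-q^n/abc) holds. -/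
open scoped BigOperators

open Filter Topology Set

theorem multipliableLocallyUniformlyOn_poch {q : ℂ} (hq : ‖q‖ < 1) :
    MultipliableLocallyUniformlyOn (fun (n : ℕ) (x : ℂ) ↦ 1 - x * q ^ n) univ := by
  use fun x ↦ ∏' n : ℕ, (1 - x * q ^ n)
  simp_rw [sub_eq_add_neg]
  refine hasProdLocallyUniformlyOn_of_forall_compact isOpen_univ fun K _ hK ↦ ?_
  obtain ⟨M, hM⟩ := hK.isBounded.exists_norm_le
  refine ((summable_geometric_of_lt_one (norm_nonneg q) hq).mul_left M).hasProdUniformlyOn_nat_one_add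
    hK (.of_forall fun n x hx ↦ ?_) (fun _ ↦ by fun_prop)
  simpa using mul_le_mul_of_nonneg_right (hM x hx) (by positivity)

theorem summable_norm_mul_pow {q : ℂ} (hq : ‖q‖ < 1) (x : ℂ) :
    Summable fun n : ℕ ↦ ‖-(x * q ^ n)‖ := by
  simpa using (summable_geometric_of_lt_one (norm_nonneg q) hq).mul_left ‖x‖

theorem differentiable_poch {q : ℂ} (hq : ‖q‖ < 1) : Differentiable ℂ (poch · q) := by
  rw [← differentiableOn_univ]
  exact (multipliableLocallyUniformlyOn_poch hq).hasProdLocallyUniformlyOn.differentiableOn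
    (.of_forall fun _ ↦ by simpa [Finset.prod_fn] using
      DifferentiableOn.finsetProd (fun _ _ ↦ by fun_prop)) isOpen_univ

theorem poch_eq_mul {q : ℂ} (hq : ‖q‖ < 1) (x : ℂ) :
    poch x q = (1 - x) * poch (x * q) q := by
  have e (n : ℕ) : 1 - x * q ^ (n + 1) = 1 - x * q * q ^ n := by rw [pow_succ', mul_assoc]
  have h : Multipliable fun n : ℕ ↦ 1 - x * q ^ (n + 1) := by
    simp_rw [e]
    exact (multipliableLocallyUniformlyOn_poch hq).multipliable (mem_univ (x * q))
  have h0 : ∏' n : ℕ, (1 - x * q ^ n) = (1 - x * q ^ 0) * ∏' n : ℕ, (1 - x * q ^ (n + 1)) :=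
    tprod_eq_zero_mul' h
  simp_rw [e] at h0
  simpa [poch] using h0

theorem poch_ne_zero_s12 {q x : ℂ} (hq : ‖q‖ < 1) (h : ∀ n : ℕ, x * q ^ n ≠ 1) : poch x q ≠ 0 := by
  have := tprod_one_add_ne_zero_of_summable (f := fun n : ℕ ↦ -(x * q ^ n))
    (fun n ↦ by rw [← sub_eq_add_neg, sub_ne_zero]; exact (h n).symm) (summable_norm_mul_pow hq x)
  simpa [poch, sub_eq_add_neg] using this

theorem poch_self_ne_zero_s12 {q : ℂ} (hq : ‖q‖ < 1) : poch q q ≠ 0 := by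
  refine poch_ne_zero_s12 hq fun n h ↦ ?_
  have := congrArg norm h
  rw [← pow_succ', norm_pow, norm_one] at this
  exact (pow_lt_one₀ (norm_nonneg q) hq n.succ_ne_zero).ne this

theorem logDeriv_poch {q x : ℂ} (hq : ‖q‖ < 1) (h : ∀ n : ℕ, x * q ^ n ≠ 1) :
    logDeriv (poch · q) x = ∑' n : ℕ, -q ^ n / (1 - x * q ^ n) := by
  have hd (n : ℕ) : logDeriv (fun x ↦ 1 - x * q ^ n) x = -q ^ n / (1 - x * q ^ n) := by
    rw [logDeriv_apply]
    simp
  have hs : Summable fun n : ℕ ↦ -q ^ n / (1 - x * q ^ n) := by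
    have h0 : Tendsto (fun n : ℕ ↦ (1 - x * q ^ n)⁻¹) atTop (𝓝 1) := by
      simpa using ((tendsto_pow_atTop_nhds_zero_of_norm_lt_one hq).const_mul x).const_sub 1 |>.inv₀
        (by simp)
    refine summable_of_isBigO_nat (summable_geometric_of_lt_one (norm_nonneg q) hq) ?_
    simpa [div_eq_mul_inv] using
      (Asymptotics.isBigO_of_le (l := atTop) (f := fun n : ℕ ↦ -q ^ n) (g := fun n : ℕ ↦ ‖q‖ ^ n)
        (by simp)).mul (h0.isBigO_one ℝ)
  have := logDeriv_tprod_eq_tsum (f := fun (n : ℕ) (x : ℂ) ↦ 1 - x * q ^ n) isOpen_univ (mem_univ x)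
    (fun n ↦ sub_ne_zero.2 (h n).symm) (fun n ↦ by fun_prop) (hs.congr fun n ↦ (hd n).symm)
    (multipliableLocallyUniformlyOn_poch hq) (poch_ne_zero_s12 hq h)
  simp_rw [hd] at this
  exact this

/-- The modified theta function `(x; q)_∞ (q / x; q)_∞`. -/
noncomputable def qTheta (q x : ℂ) : ℂ := poch x q * poch (q / x) q

theorem qTheta_eq_mul {q : ℂ} (hq : ‖q‖ < 1) (x : ℂ) :
    qTheta q x = (1 - x) * (poch (x * q) q * poch (q / x) q) := by
  rw [qTheta, poch_eq_mul hq, mul_assoc]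

theorem qTheta_inv {q x : ℂ} (hq : ‖q‖ < 1) (hx : x ≠ 0) :
    qTheta q x⁻¹ = -x⁻¹ * qTheta q x := by
  rw [qTheta_eq_mul hq, qTheta_eq_mul hq x, div_inv_eq_mul, mul_comm q x, inv_mul_eq_div]
  field_simp
  ring

theorem qTheta_q_mul {q x : ℂ} (hq0 : q ≠ 0) (hq : ‖q‖ < 1) (hx : x ≠ 0) :
    qTheta q (q * x) = -x⁻¹ * qTheta q x := by
  rw [qTheta_eq_mul hq x, qTheta, div_mul_cancel_left₀ hq0, poch_eq_mul hq x⁻¹, mul_comm q x,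
    inv_mul_eq_div]
  field_simp
  ring

theorem differentiableAt_qTheta {q x : ℂ} (hq : ‖q‖ < 1) (hx : x ≠ 0) :
    DifferentiableAt ℂ (qTheta q) x :=
  (differentiable_poch hq x).mul
    ((differentiable_poch hq (q / x)).comp x (by fun_prop (disch := exact hx)))

theorem qTheta_ne_zero {q x : ℂ} (hq : ‖q‖ < 1) (hx : x ≠ 0)
    (h : ∀ k : ℤ, x ≠ q ^ k) : qTheta q x ≠ 0 := by
  refine mul_ne_zero (poch_ne_zero_s12 hq fun n hn ↦ h (-n) ?_) (poch_ne_zero_s12 hq fun n hn ↦ h (n + 1) ?_)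
  · rw [zpow_neg, zpow_natCast]
    exact eq_inv_of_mul_eq_one_left hn
  · field_simp at hn
    exact_mod_cast hn.symm.trans (pow_succ' q n).symm

theorem exists_eq_zpow_of_qTheta_eq_zero {q x : ℂ} (hq : ‖q‖ < 1) (hx : x ≠ 0)
    (h : qTheta q x = 0) : ∃ k : ℤ, x = q ^ k := by
  contrapose! h
  exact qTheta_ne_zero hq hx h

theorem qTheta_one {q : ℂ} (hq : ‖q‖ < 1) : qTheta q 1 = 0 := by
  simp [qTheta_eq_mul hq]

theorem qTheta_q_mul_ne_zero_iff {q x : ℂ} (hq0 : q ≠ 0) (hq : ‖q‖ < 1) (hx : x ≠ 0) :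
    qTheta q (q * x) ≠ 0 ↔ qTheta q x ≠ 0 := by
  simp [qTheta_q_mul hq0 hq hx, hx]

theorem qTheta_inv_ne_zero_iff {q x : ℂ} (hq : ‖q‖ < 1) (hx : x ≠ 0) :
    qTheta q x⁻¹ ≠ 0 ↔ qTheta q x ≠ 0 := by
  simp [qTheta_inv hq hx, hx]

theorem qTheta_zpow {q : ℂ} (hq0 : q ≠ 0) (hq : ‖q‖ < 1) (k : ℤ) : qTheta q (q ^ k) = 0 := by
  have step (k : ℤ) : qTheta q (q ^ (k + 1)) = 0 ↔ qTheta q (q ^ k) = 0 := by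
    rw [zpow_add_one₀ hq0, mul_comm]
    exact not_iff_not.1 (qTheta_q_mul_ne_zero_iff hq0 hq (zpow_ne_zero k hq0))
  induction k with
  | zero => simpa using qTheta_one hq
  | succ n ih => exact (step n).2 ih
  | pred n ih => exact (step (-n - 1)).1 (by simpa using ih)

theorem qTheta_ne_zero_iff {q x : ℂ} (hq0 : q ≠ 0) (hq : ‖q‖ < 1) (hx : x ≠ 0) :
    qTheta q x ≠ 0 ↔ ∀ k : ℤ, x ≠ q ^ k :=
  ⟨fun h k hk ↦ h (hk ▸ qTheta_zpow hq0 hq k), qTheta_ne_zero hq hx⟩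

/-- The Eulerian derivative `-x θ'(x) / θ(x)` of the modified theta function. -/
noncomputable def qZeta (q x : ℂ) : ℂ := -x * logDeriv (qTheta q) x

theorem qZeta_q_mul {q x : ℂ} (hq0 : q ≠ 0) (hq : ‖q‖ < 1) (hx : x ≠ 0) (h : qTheta q x ≠ 0) :
    qZeta q (q * x) = qZeta q x + 1 := by
  have hqx := mul_ne_zero hq0 hx
  have h1 : logDeriv (qTheta q ∘ (q * ·)) x = logDeriv (fun y ↦ -y⁻¹ * qTheta q y) x := by
    refine (logDeriv_congr_nhds ?_).eq_of_nhds
    filter_upwards [isOpen_ne.mem_nhds hx] with y hy using qTheta_q_mul hq0 hq hy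
  rw [logDeriv_comp (differentiableAt_qTheta hq hqx) (by fun_prop),
    logDeriv_mul (f := fun y ↦ -y⁻¹) x (by simpa) h (by fun_prop (disch := exact hx))
      (differentiableAt_qTheta hq hx)] at h1
  have h2 : logDeriv (fun y : ℂ ↦ -y⁻¹) x = -1 / x := by
    rw [← logDeriv_inv x, logDeriv_apply, logDeriv_apply, deriv.fun_neg, neg_div_neg_eq]
  have h3 : deriv (q * ·) x = q := by simp
  rw [h2, h3] at h1
  rw [qZeta, qZeta, neg_mul, mul_right_comm, mul_comm q, h1]
  field_simp
  ring

theorem qZeta_inv {q x : ℂ} (hq : ‖q‖ < 1) (hx : x ≠ 0) (h : qTheta q x ≠ 0) :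
    qZeta q x⁻¹ = -qZeta q x - 1 := by
  have hx' := inv_ne_zero hx
  have h1 : logDeriv (qTheta q ∘ (·⁻¹)) x = logDeriv (fun y ↦ -y⁻¹ * qTheta q y) x := by
    refine (logDeriv_congr_nhds ?_).eq_of_nhds
    filter_upwards [isOpen_ne.mem_nhds hx] with y hy using qTheta_inv hq hy
  rw [logDeriv_comp (differentiableAt_qTheta hq hx') (by fun_prop (disch := exact hx)),
    logDeriv_mul (f := fun y ↦ -y⁻¹) x (by simpa) h (by fun_prop (disch := exact hx))
      (differentiableAt_qTheta hq hx)] at h1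
  have h2 : logDeriv (fun y : ℂ ↦ -y⁻¹) x = -1 / x := by
    rw [← logDeriv_inv x, logDeriv_apply, logDeriv_apply, deriv.fun_neg, neg_div_neg_eq]
  rw [h2, deriv_inv] at h1
  rw [qZeta, qZeta]
  field_simp at h1 ⊢
  linear_combination h1

theorem qZeta_zpow_mul {q x : ℂ} (hq0 : q ≠ 0) (hq : ‖q‖ < 1) (hx : x ≠ 0) (h : qTheta q x ≠ 0)
    (k : ℤ) : qZeta q (q ^ k * x) = qZeta q x + k := by
  have step (k : ℤ) : qZeta q (q ^ (k + 1) * x) = qZeta q (q ^ k * x) + 1 := by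
    have hk := mul_ne_zero (zpow_ne_zero k hq0) hx
    rw [zpow_add_one₀ hq0, mul_comm _ q, mul_assoc]
    refine qZeta_q_mul hq0 hq hk ?_
    rw [qTheta_ne_zero_iff hq0 hq hk]
    rw [qTheta_ne_zero_iff hq0 hq hx] at h
    intro j hj
    refine h (j - k) ?_
    rw [zpow_sub₀ hq0, ← hj]
    field_simp
  induction k with
  | zero => simp
  | succ n ih => rw [step, ih]; push_cast; ring
  | pred n ih =>
    have := step (-n - 1)
    rw [sub_add_cancel, ih] at this
    push_cast at this ⊢
    linear_combination -this

theorem qZeta_eq_tsum {q x : ℂ} (hq : ‖q‖ < 1) (hx : x ≠ 0)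
    (h : ∀ k : ℤ, x ≠ q ^ k) :
    qZeta q x = ∑' n : ℕ, x * q ^ n / (1 - x * q ^ n)
      - ∑' n : ℕ, (q ^ (n + 1) / x) / (1 - q ^ (n + 1) / x) := by
  have h1 : ∀ n : ℕ, x * q ^ n ≠ 1 := fun n hn ↦ h (-n) <| by
    rw [zpow_neg, zpow_natCast]
    exact eq_inv_of_mul_eq_one_left hn
  have h2 : ∀ n : ℕ, q / x * q ^ n ≠ 1 := fun n hn ↦ h (n + 1) <| by
    field_simp at hn
    exact_mod_cast hn.symm.trans (pow_succ' q n).symm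
  have h3 : deriv (fun y ↦ q / y) x = -q / x ^ 2 := by
    simp [div_eq_mul_inv]
  have hd : DifferentiableAt ℂ (fun y ↦ q / y) x := by fun_prop (disch := exact hx)
  have h4 : logDeriv (qTheta q) x =
      logDeriv (poch · q) x + logDeriv (poch · q) (q / x) * (-q / x ^ 2) := by
    rw [← h3, ← logDeriv_comp (differentiable_poch hq _) hd]
    exact logDeriv_mul x (poch_ne_zero_s12 hq h1) (poch_ne_zero_s12 hq h2) (differentiable_poch hq x)
      ((differentiable_poch hq _).comp x hd)
  rw [qZeta, h4, logDeriv_poch hq h1, logDeriv_poch hq h2, mul_add, ← mul_assoc, mul_right_comm,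
    ← tsum_mul_left, ← tsum_mul_left, sub_eq_add_neg, ← tsum_neg]
  congr 2 <;> ext n
  · ring
  · rw [div_mul_eq_mul_div, ← pow_succ']
    field_simp
    ring

theorem ContinuousAt.tendsto_nhdsNE_of_injective {φ : ℂ → ℂ} {x : ℂ} (hφ : ContinuousAt φ x)
    (hi : Function.Injective φ) : Tendsto φ (𝓝[≠] x) (𝓝[≠] (φ x)) :=
  tendsto_nhdsWithin_iff.2 ⟨hφ.tendsto.mono_left nhdsWithin_le_nhds,
    eventually_nhdsWithin_of_forall fun _ hy ↦ hi.ne hy⟩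

theorem exists_zpow_mul_norm_mem_Icc {q x : ℂ} (hq0 : q ≠ 0) (hq : ‖q‖ < 1) (hx : x ≠ 0) :
    ∃ k : ℤ, ‖q ^ k * x‖ ∈ Icc 1 ‖q‖⁻¹ := by
  have hq' : 0 < ‖q‖ := norm_pos_iff.2 hq0
  obtain ⟨n, h1, h2⟩ := exists_mem_Ico_zpow (norm_pos_iff.2 hx) ((one_lt_inv₀ hq').2 hq)
  refine ⟨n, ?_⟩
  have hn : 0 < ‖q‖ ^ n := zpow_pos hq' n
  rw [inv_zpow] at h1 h2
  rw [zpow_add_one₀ hq'.ne', mul_inv] at h2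
  rw [norm_mul, norm_zpow]
  constructor
  · rwa [inv_le_iff_one_le_mul₀' hn] at h1
  · rw [lt_inv_mul_iff₀ hn] at h2
    exact h2.le

/-- A `q`-periodic function on `ℂ ∖ {0}` all of whose singularities are isolated and removable is
constant. -/
theorem exists_const_of_q_periodic {q : ℂ} (hq0 : q ≠ 0) (hq : ‖q‖ < 1) {f : ℂ → ℂ}
    (hd : ∀ x ≠ 0, ∀ᶠ y in 𝓝[≠] x, DifferentiableAt ℂ f y)
    (hl : ∀ x ≠ 0, ∃ l, Tendsto f (𝓝[≠] x) (𝓝 l))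
    (hp : ∀ x ≠ 0, ∀ᶠ y in 𝓝[≠] x, f (q * y) = f y) :
    ∃ C, ∀ x ≠ 0, ContinuousAt f x → f x = C := by
  set F : ℂ → ℂ := fun x ↦ limUnder (𝓝[≠] x) f with hF
  have hlim (x : ℂ) (hx : x ≠ 0) : Tendsto f (𝓝[≠] x) (𝓝 (F x)) := tendsto_nhds_limUnder (hl x hx)
  have hFf {x : ℂ} (h : ContinuousAt f x) : F x = f x :=
    (h.tendsto.mono_left nhdsWithin_le_nhds).limUnder_eq
  have hFd (x : ℂ) (hx : x ≠ 0) : DifferentiableAt ℂ F x := by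
    have hu : F =ᶠ[𝓝 x] Function.update f x (F x) := by
      filter_upwards [eventually_nhdsWithin_iff.1 (hd x hx)] with y hy
      rcases eq_or_ne y x with rfl | hne
      · simp
      · rw [Function.update_of_ne hne, hFf (hy hne).continuousAt]
    have hc : ContinuousAt F x := by
      rw [continuousAt_congr hu]
      exact continuousAt_update_same.2 (hlim x hx)
    refine (Complex.analyticAt_of_differentiable_on_punctured_nhds_of_continuousAt ?_
      hc).differentiableAt
    filter_upwards [hd x hx, eventually_nhdsNE_eventually_nhds_iff.2 (hd x hx)] with y hy hy'
    have : F =ᶠ[𝓝 y] f := hy'.mono fun z hz ↦ hFf hz.continuousAt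
    exact hy.congr_of_eventuallyEq this
  have hFq (x : ℂ) (hx : x ≠ 0) : F (q * x) = F x := by
    have h1 : Tendsto (q * ·) (𝓝[≠] x) (𝓝[≠] (q * x)) :=
      ContinuousAt.tendsto_nhdsNE_of_injective (by fun_prop) (mul_right_injective₀ hq0)
    exact tendsto_nhds_unique (((hlim _ (mul_ne_zero hq0 hx)).comp h1).congr' (hp x hx)) (hlim x hx)
  have hFk (k : ℤ) (x : ℂ) (hx : x ≠ 0) : F (q ^ k * x) = F x := by
    have step (k : ℤ) : F (q ^ (k + 1) * x) = F (q ^ k * x) := by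
      rw [zpow_add_one₀ hq0, mul_comm _ q, mul_assoc, hFq _ (mul_ne_zero (zpow_ne_zero k hq0) hx)]
    induction k with
    | zero => simp
    | succ n ih => rw [step, ih]
    | pred n ih => rw [← step, sub_add_cancel, ih]
  have hK : IsCompact {x : ℂ | ‖x‖ ∈ Icc 1 ‖q‖⁻¹} := by
    refine Metric.isCompact_of_isClosed_isBounded (isClosed_Icc.preimage continuous_norm) ?_
    exact isBounded_iff_forall_norm_le.2 ⟨‖q‖⁻¹, fun x hx ↦ hx.2⟩
  have hFc : ContinuousOn F {x : ℂ | ‖x‖ ∈ Icc 1 ‖q‖⁻¹} := fun x hx ↦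
    (hFd x (norm_pos_iff.1 (one_pos.trans_le hx.1))).continuousAt.continuousWithinAt
  have hb : Bornology.IsBounded (range (F ∘ Complex.exp)) := by
    refine (hK.image_of_continuousOn hFc).isBounded.subset ?_
    rintro _ ⟨z, rfl⟩
    obtain ⟨k, hk⟩ := exists_zpow_mul_norm_mem_Icc hq0 hq (Complex.exp_ne_zero z)
    exact ⟨_, hk, hFk k _ (Complex.exp_ne_zero z)⟩
  have hD : Differentiable ℂ (F ∘ Complex.exp) := fun z ↦
    (hFd _ (Complex.exp_ne_zero z)).comp z Complex.differentiableAt_exp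
  obtain ⟨C, hC⟩ := hD.exists_const_forall_eq_of_bounded hb
  refine ⟨C, fun x hx hfx ↦ ?_⟩
  rw [← hFf hfx, ← hC (Complex.log x), Function.comp_apply, Complex.exp_log hx]

theorem analyticOnNhd_qTheta {q : ℂ} (hq : ‖q‖ < 1) : AnalyticOnNhd ℂ (qTheta q) {0}ᶜ :=
  DifferentiableOn.analyticOnNhd
    (fun _ hx ↦ (differentiableAt_qTheta hq hx).differentiableWithinAt) isOpen_compl_singleton

theorem differentiableAt_qZeta {q x : ℂ} (hq : ‖q‖ < 1) (hx : x ≠ 0) (h : qTheta q x ≠ 0) :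
    DifferentiableAt ℂ (qZeta q) x :=
  differentiableAt_id.neg.mul
    ((analyticOnNhd_qTheta hq x hx).deriv.differentiableAt.div (differentiableAt_qTheta hq hx) h)

theorem eventually_qTheta_ne_zero {q b x : ℂ} (hq : ‖q‖ < 1) (hb0 : b ≠ 0)
    (hb : qTheta q b ≠ 0) (hx : x ≠ 0) : ∀ᶠ y in 𝓝[≠] x, qTheta q y ≠ 0 := by
  by_contra h
  have h' : ∃ᶠ y in 𝓝[≠] x, qTheta q y = 0 := by
    rw [Filter.Frequently]
    exact h
  exact hb ((analyticOnNhd_qTheta hq).eqOn_zero_of_preconnected_of_frequently_eq_zero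
    (isConnected_compl_singleton_of_one_lt_rank (by simp) 0).isPreconnected hx h' hb0)

/-- The difference of the two sides of the Andrews–Lewis–Liu identity, as a function of the first
variable. -/
noncomputable def allDiff (q b c x : ℂ) : ℂ :=
  qTheta q (x * b) * qTheta q (b * c) * qTheta q (c * x) * poch q q ^ 2
      / (qTheta q x * qTheta q b * qTheta q c * qTheta q (x * b * c))
    - (1 + qZeta q x + qZeta q b + qZeta q c - qZeta q (x * b * c))

section

variable {q b c x : ℂ}

theorem allDiff_q_mul (hq0 : q ≠ 0) (hq : ‖q‖ < 1) (hb0 : b ≠ 0) (hc0 : c ≠ 0) (hx0 : x ≠ 0)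
    (hx : qTheta q x ≠ 0) (hxbc : qTheta q (x * b * c) ≠ 0) :
    allDiff q b c (q * x) = allDiff q b c x := by
  have h0 : x * b * c ≠ 0 := by simp [*]
  rw [allDiff, allDiff, show c * (q * x) = q * (c * x) by ring, mul_assoc q x b,
    mul_assoc q _ c, qTheta_q_mul hq0 hq (mul_ne_zero hx0 hb0), qTheta_q_mul hq0 hq hx0,
    qTheta_q_mul hq0 hq (mul_ne_zero hc0 hx0), qTheta_q_mul hq0 hq h0, qZeta_q_mul hq0 hq hx0 hx,
    qZeta_q_mul hq0 hq h0 hxbc]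
  congr 1
  · field_simp
  · ring

theorem allDiff_inv (hq : ‖q‖ < 1) (hb0 : b ≠ 0) (hc0 : c ≠ 0) (hx0 : x ≠ 0)
    (hx : qTheta q x ≠ 0) (hxbc : qTheta q (x * b * c) ≠ 0) :
    allDiff q b c (x * b * c)⁻¹ = allDiff q b c x := by
  have h0 : x * b * c ≠ 0 := by simp [*]
  rw [allDiff, allDiff, show (x * b * c)⁻¹ * b = (c * x)⁻¹ by field_simp,
    show c * (x * b * c)⁻¹ = (x * b)⁻¹ by field_simp,
    show (c * x)⁻¹ * c = x⁻¹ by field_simp,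
    qTheta_inv hq (mul_ne_zero hx0 hb0), qTheta_inv hq hx0,
    qTheta_inv hq (mul_ne_zero hc0 hx0), qTheta_inv hq h0, qZeta_inv hq hx0 hx,
    qZeta_inv hq h0 hxbc]
  congr 1
  · field_simp
  · ring

theorem differentiableAt_allDiff (hq : ‖q‖ < 1) (hb0 : b ≠ 0) (hc0 : c ≠ 0)
    (hb : qTheta q b ≠ 0) (hc : qTheta q c ≠ 0) (hx0 : x ≠ 0)
    (hx : qTheta q x ≠ 0) (hxbc : qTheta q (x * b * c) ≠ 0) :
    DifferentiableAt ℂ (allDiff q b c) x := by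
  have h1 := differentiableAt_qTheta hq hx0
  have h2 : DifferentiableAt ℂ (fun x ↦ qTheta q (x * b)) x :=
    (differentiableAt_qTheta hq (mul_ne_zero hx0 hb0)).comp x (f := (· * b)) (by fun_prop)
  have h3 : DifferentiableAt ℂ (fun x ↦ qTheta q (c * x)) x :=
    (differentiableAt_qTheta hq (mul_ne_zero hc0 hx0)).comp x (f := (c * ·)) (by fun_prop)
  have h0 : x * b * c ≠ 0 := by simp [*]
  have h4 : DifferentiableAt ℂ (fun x ↦ qTheta q (x * b * c)) x :=
    (differentiableAt_qTheta hq h0).comp x (f := (· * b * c)) (by fun_prop)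
  have h5 := differentiableAt_qZeta hq hx0 hx
  have h6 : DifferentiableAt ℂ (fun x ↦ qZeta q (x * b * c)) x :=
    (differentiableAt_qZeta hq h0 hxbc).comp x (f := (· * b * c)) (by fun_prop)
  have h7 := mul_ne_zero (mul_ne_zero (mul_ne_zero hx hb) hc) hxbc
  unfold allDiff
  fun_prop (disch := exact h7)

theorem tendsto_sub_one_mul_allDiff (hq : ‖q‖ < 1) (hb0 : b ≠ 0) (hc0 : c ≠ 0)
    (hb : qTheta q b ≠ 0) (hc : qTheta q c ≠ 0) (hbc : qTheta q (b * c) ≠ 0) :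
    Tendsto (fun x ↦ (x - 1) * allDiff q b c x) (𝓝[≠] 1) (𝓝 0) := by
  set η : ℂ → ℂ := fun x ↦ poch (x * q) q * poch (q / x) q with hη
  have hη1 : η 1 = poch q q ^ 2 := by simp [hη, sq]
  have hη0 : η 1 ≠ 0 := by rw [hη1]; exact pow_ne_zero 2 (poch_self_ne_zero_s12 hq)
  have hηd : DifferentiableAt ℂ η 1 :=
    ((differentiable_poch hq _).comp 1 (f := (· * q)) (by fun_prop)).mul
      ((differentiable_poch hq _).comp 1 (f := fun x ↦ q / x)
        (by fun_prop (disch := exact one_ne_zero)))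
  have hθ (x : ℂ) : qTheta q x = (1 - x) * η x := qTheta_eq_mul hq x
  have hθ' : deriv (qTheta q) 1 = -η 1 := by
    have : HasDerivAt (qTheta q) (-1 * η 1 + (1 - 1) * deriv η 1) 1 := by
      rw [show qTheta q = fun x ↦ (1 - x) * η x from funext hθ]
      exact ((hasDerivAt_id (1 : ℂ)).const_sub 1).mul hηd.hasDerivAt
    simpa using this.deriv
  set H : ℂ → ℂ := fun x ↦
    -(qTheta q (x * b) * qTheta q (b * c) * qTheta q (c * x) * poch q q ^ 2
      / (η x * qTheta q b * qTheta q c * qTheta q (x * b * c)))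
    - (x - 1) * (1 + qZeta q b + qZeta q c - qZeta q (x * b * c))
    - x * deriv (qTheta q) x / η x with hH
  have h2 : ContinuousAt (fun x ↦ qTheta q (x * b)) 1 :=
    ContinuousAt.comp (g := qTheta q) (f := (· * b)) (x := 1)
      (by simpa using (differentiableAt_qTheta hq hb0).continuousAt)
      (by fun_prop)
  have h3 : ContinuousAt (fun x ↦ qTheta q (c * x)) 1 :=
    ContinuousAt.comp (g := qTheta q) (f := (c * ·)) (x := 1)
      (by simpa using (differentiableAt_qTheta hq hc0).continuousAt)
      (by fun_prop)
  have h4 : ContinuousAt (fun x ↦ qTheta q (x * b * c)) 1 :=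
    ContinuousAt.comp (g := qTheta q) (f := (· * b * c)) (x := 1)
      (by simpa using (differentiableAt_qTheta hq (mul_ne_zero hb0 hc0)).continuousAt) (by fun_prop)
  have h5 : ContinuousAt (fun x ↦ qZeta q (x * b * c)) 1 :=
    ContinuousAt.comp (g := qZeta q) (f := (· * b * c)) (x := 1)
      (by simpa using (differentiableAt_qZeta hq (mul_ne_zero hb0 hc0) hbc).continuousAt)
      (by fun_prop)
  have h6 : ContinuousAt (deriv (qTheta q)) 1 :=
    (analyticOnNhd_qTheta hq 1 (by simp)).deriv.continuousAt
  have h7 := hηd.continuousAt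
  have hHc : ContinuousAt H 1 := by
    have h8 : η 1 * qTheta q b * qTheta q c * qTheta q (1 * b * c) ≠ 0 := by
      rw [one_mul]
      exact mul_ne_zero (mul_ne_zero (mul_ne_zero hη0 hb) hc) hbc
    rw [hH]
    fun_prop (disch := assumption)
  have hH1 : H 1 = 0 := by
    simp only [hH, one_mul, mul_one, hθ', sub_self, zero_mul, sub_zero]
    rw [neg_div, div_self hη0, hη1]
    have := poch_self_ne_zero_s12 hq
    field_simp
    ring
  have hHt : Tendsto H (𝓝[≠] 1) (𝓝 0) := by
    rw [← hH1]
    exact hHc.tendsto.mono_left nhdsWithin_le_nhds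
  refine hHt.congr' ?_
  filter_upwards [self_mem_nhdsWithin,
    nhdsWithin_le_nhds (h7.eventually_ne hη0)] with x hx1 hηx
  have hx1' : 1 - x ≠ 0 := sub_ne_zero.2 (Ne.symm hx1)
  rw [hH, allDiff, show qZeta q x = -x * (deriv (qTheta q) x / qTheta q x) from rfl, hθ x]
  simp only
  generalize qTheta q (x * b * c) = t
  have e1 : (x - 1) * (qTheta q (x * b) * qTheta q (b * c) * qTheta q (c * x) * poch q q ^ 2
      / ((1 - x) * η x * qTheta q b * qTheta q c * t)) =
      -(qTheta q (x * b) * qTheta q (b * c) * qTheta q (c * x) * poch q q ^ 2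
      / (η x * qTheta q b * qTheta q c * t)) := by
    rw [show (1 - x) * η x * qTheta q b * qTheta q c * t
      = (1 - x) * (η x * qTheta q b * qTheta q c * t) by ring, ← div_div, ← neg_sub 1 x, neg_mul,
      ← mul_div_assoc, mul_div_cancel₀ _ hx1']
  have e2 : (x - 1) * (x * (deriv (qTheta q) x / ((1 - x) * η x))) =
      - (x * deriv (qTheta q) x / η x) := by
    field_simp
    ring
  linear_combination -e1 - e2

theorem allDiff_eq_zero (hq0 : q ≠ 0) (hq : ‖q‖ < 1) (hb0 : b ≠ 0) (hc0 : c ≠ 0) (hx0 : x ≠ 0)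
    (hb : qTheta q b ≠ 0) (hc : qTheta q c ≠ 0) (hbc : qTheta q (b * c) ≠ 0)
    (hx : qTheta q x ≠ 0) (hxbc : qTheta q (x * b * c) ≠ 0) :
    allDiff q b c x = 0 := by
  have hgood (x : ℂ) (hx0 : x ≠ 0) :
      ∀ᶠ y in 𝓝[≠] x, y ≠ 0 ∧ qTheta q y ≠ 0 ∧ qTheta q (y * b * c) ≠ 0 := by
    have ht : Tendsto (· * b * c) (𝓝[≠] x) (𝓝[≠] (x * b * c)) :=
      ContinuousAt.tendsto_nhdsNE_of_injective (by fun_prop)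
        ((mul_left_injective₀ hc0).comp (mul_left_injective₀ hb0))
    exact (eventually_nhdsWithin_of_eventually_nhds (eventually_ne_nhds hx0)).and
      ((eventually_qTheta_ne_zero hq hb0 hb hx0).and
        (ht.eventually (eventually_qTheta_ne_zero hq hb0 hb (by simp [*]))))
  have hd (x : ℂ) (hx0 : x ≠ 0) : ∀ᶠ y in 𝓝[≠] x, DifferentiableAt ℂ (allDiff q b c) y :=
    (hgood x hx0).mono fun y hy ↦ differentiableAt_allDiff hq hb0 hc0 hb hc hy.1 hy.2.1 hy.2.2
  have hp (x : ℂ) (hx0 : x ≠ 0) : ∀ᶠ y in 𝓝[≠] x, allDiff q b c (q * y) = allDiff q b c y :=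
    (hgood x hx0).mono fun y hy ↦ allDiff_q_mul hq0 hq hb0 hc0 hy.1 hy.2.1 hy.2.2
  have hlim_one : ∃ l, Tendsto (allDiff q b c) (𝓝[≠] 1) (𝓝 l) := by
    refine ⟨_, Complex.tendsto_limUnder_of_differentiable_on_punctured_nhds_of_isLittleO
      (hd 1 one_ne_zero) ?_⟩
    refine (Asymptotics.isLittleO_iff_tendsto' (eventually_nhdsWithin_of_forall fun y hy h ↦
      absurd h (inv_ne_zero (sub_ne_zero.2 hy)))).2 ?_
    have h1 : Tendsto (fun y : ℂ ↦ (y - 1) * allDiff q b c 1) (𝓝[≠] 1) (𝓝 0) := by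
      have : ContinuousAt (fun y : ℂ ↦ (y - 1) * allDiff q b c 1) 1 := by fun_prop
      simpa using this.tendsto.mono_left nhdsWithin_le_nhds
    have h2 := (tendsto_sub_one_mul_allDiff hq hb0 hc0 hb hc hbc).sub h1
    rw [sub_zero] at h2
    refine h2.congr fun y ↦ ?_
    rw [div_inv_eq_mul]
    ring
  have hlim_zpow (k : ℤ) : ∃ l, Tendsto (allDiff q b c) (𝓝[≠] (q ^ k)) (𝓝 l) := by
    induction k with
    | zero => simpa using hlim_one
    | succ n ih =>
      obtain ⟨l, hl⟩ := ih
      have ht : Tendsto (q⁻¹ * ·) (𝓝[≠] (q ^ ((n : ℤ) + 1))) (𝓝[≠] (q ^ (n : ℤ))) := by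
        have := ContinuousAt.tendsto_nhdsNE_of_injective (φ := (q⁻¹ * ·))
          (x := q ^ ((n : ℤ) + 1)) (by fun_prop) (mul_right_injective₀ (inv_ne_zero hq0))
        rwa [show q⁻¹ * q ^ ((n : ℤ) + 1) = q ^ (n : ℤ) by
          rw [zpow_add_one₀ hq0, mul_comm _ q, inv_mul_cancel_left₀ hq0]] at this
      refine ⟨l, (hl.comp ht).congr' ?_⟩
      filter_upwards [ht.eventually (hp _ (zpow_ne_zero _ hq0))] with y hy
      rw [mul_inv_cancel_left₀ hq0] at hy
      exact hy.symm
    | pred n ih =>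
      obtain ⟨l, hl⟩ := ih
      have ht : Tendsto (q * ·) (𝓝[≠] (q ^ (-(n : ℤ) - 1))) (𝓝[≠] (q ^ (-(n : ℤ)))) := by
        have := ContinuousAt.tendsto_nhdsNE_of_injective (φ := (q * ·))
          (x := q ^ (-(n : ℤ) - 1)) (by fun_prop) (mul_right_injective₀ hq0)
        rwa [show q * q ^ (-(n : ℤ) - 1) = q ^ (-(n : ℤ)) by
          rw [mul_comm q, ← zpow_add_one₀ hq0, sub_add_cancel]] at this
      exact ⟨l, (hl.comp ht).congr' (hp _ (zpow_ne_zero _ hq0))⟩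
  have hl (x : ℂ) (hx0 : x ≠ 0) : ∃ l, Tendsto (allDiff q b c) (𝓝[≠] x) (𝓝 l) := by
    by_cases hx : qTheta q x = 0
    · obtain ⟨k, rfl⟩ := exists_eq_zpow_of_qTheta_eq_zero hq hx0 hx
      exact hlim_zpow k
    by_cases hxbc : qTheta q (x * b * c) = 0
    · have h0 : x * b * c ≠ 0 := by simp [*]
      obtain ⟨k, hk⟩ := exists_eq_zpow_of_qTheta_eq_zero hq h0 hxbc
      obtain ⟨l, hl⟩ := hlim_zpow (-k)
      have ht : Tendsto (fun y ↦ (y * b * c)⁻¹) (𝓝[≠] x) (𝓝[≠] ((x * b * c)⁻¹)) :=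
        ContinuousAt.tendsto_nhdsNE_of_injective (by fun_prop (disch := exact h0))
          (inv_injective.comp ((mul_left_injective₀ hc0).comp (mul_left_injective₀ hb0)))
      rw [hk, ← zpow_neg] at ht
      refine ⟨l, (hl.comp ht).congr' ?_⟩
      exact (hgood x hx0).mono fun y hy ↦ allDiff_inv hq hb0 hc0 hy.1 hy.2.1 hy.2.2
    · exact ⟨_, (differentiableAt_allDiff hq hb0 hc0 hb hc hx0 hx hxbc).continuousAt.tendsto.mono_left
        nhdsWithin_le_nhds⟩
  obtain ⟨C, hC⟩ := exists_const_of_q_periodic hq0 hq hd hl hp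
  have hb0' := inv_ne_zero hb0
  have hb' := (qTheta_inv_ne_zero_iff hq hb0).2 hb
  have h1 := hC b⁻¹ hb0' (differentiableAt_allDiff hq hb0 hc0 hb hc hb0' hb'
    (by rwa [inv_mul_cancel₀ hb0, one_mul])).continuousAt
  have h2 : allDiff q b c b⁻¹ = 0 := by
    rw [allDiff, inv_mul_cancel₀ hb0, qTheta_one hq, one_mul, qZeta_inv hq hb0 hb]
    ring
  rw [hC x hx0 (differentiableAt_allDiff hq hb0 hc0 hb hc hx0 hx hxbc).continuousAt, ← h1, h2]

theorem allDiff_eq_zero_of_mul_eq_zpow (hq0 : q ≠ 0) (hq : ‖q‖ < 1) (hb0 : b ≠ 0) (hx0 : x ≠ 0)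
    (hb : qTheta q b ≠ 0) (hx : qTheta q x ≠ 0) {k : ℤ} (hbc : b * c = q ^ k) :
    allDiff q b c x = 0 := by
  have hc : c = q ^ k * b⁻¹ := by rw [← hbc]; field_simp
  rw [allDiff, mul_assoc x, hbc, qTheta_zpow hq0 hq, mul_comm x (q ^ k),
    qZeta_zpow_mul hq0 hq hx0 hx, hc,
    qZeta_zpow_mul hq0 hq (inv_ne_zero hb0) ((qTheta_inv_ne_zero_iff hq hb0).2 hb),
    qZeta_inv hq hb0 hb]
  ring

end

theorem stmt12 (q a b c : ℂ) (hq0 : 0 < ‖q‖) (hq : ‖q‖ < 1)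
    (ha0 : a ≠ 0) (hb0 : b ≠ 0) (hc0 : c ≠ 0)
    (ha : ∀ k : ℤ, a ≠ q ^ k) (hb : ∀ k : ℤ, b ≠ q ^ k)
    (hc : ∀ k : ℤ, c ≠ q ^ k) (habc : ∀ k : ℤ, a * b * c ≠ q ^ k) :
    (poch (a * b) q * poch (q / (a * b)) q) * (poch (b * c) q * poch (q / (b * c)) q)
        * (poch (c * a) q * poch (q / (c * a)) q) * (poch q q) ^ 2
      / ((poch a q * poch (q / a) q) * (poch b q * poch (q / b) q)
          * (poch c q * poch (q / c) q) * (poch (a * b * c) q * poch (q / (a * b * c)) q))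
      = 1 + (∑' n : ℕ, a * q ^ n / (1 - a * q ^ n))
          - (∑' n : ℕ, (q ^ (n + 1) / a) / (1 - q ^ (n + 1) / a))
          + (∑' n : ℕ, b * q ^ n / (1 - b * q ^ n))
          - (∑' n : ℕ, (q ^ (n + 1) / b) / (1 - q ^ (n + 1) / b))
          + (∑' n : ℕ, c * q ^ n / (1 - c * q ^ n))
          - (∑' n : ℕ, (q ^ (n + 1) / c) / (1 - q ^ (n + 1) / c))
          - (∑' n : ℕ, a * b * c * q ^ n / (1 - a * b * c * q ^ n))
          + (∑' n : ℕ, (q ^ (n + 1) / (a * b * c)) / (1 - q ^ (n + 1) / (a * b * c))) := by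
  have hq0' : q ≠ 0 := norm_pos_iff.1 hq0
  have habc0 : a * b * c ≠ 0 := by simp [*]
  have hθa := qTheta_ne_zero hq ha0 ha
  have hθb := qTheta_ne_zero hq hb0 hb
  have hθc := qTheta_ne_zero hq hc0 hc
  have hθ := qTheta_ne_zero hq habc0 habc
  have key : allDiff q b c a = 0 := by
    by_cases hbc : qTheta q (b * c) = 0
    · obtain ⟨k, hk⟩ := exists_eq_zpow_of_qTheta_eq_zero hq (mul_ne_zero hb0 hc0) hbc
      exact allDiff_eq_zero_of_mul_eq_zpow hq0' hq hb0 ha0 hθb hθa hk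
    · exact allDiff_eq_zero hq0' hq hb0 hc0 ha0 hθb hθc hbc hθa hθ
  rw [allDiff, sub_eq_zero, qZeta_eq_tsum hq ha0 ha, qZeta_eq_tsum hq hb0 hb,
    qZeta_eq_tsum hq hc0 hc, qZeta_eq_tsum hq habc0 habc] at key
  refine key.trans ?_
  ring
end
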